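/- arXiv:math/0406133 — 2 statements merged into one kernel-verified Lean document; each statement's English description precedes it below -/
import Mathlib

section
/- Let q be a nondegenerate quadratic form of rank 4 over a field k of characteristic ≠ 2 whose discriminant d(q) is not a square in k. Then the Brauer kernel κ(k(q)/k) is trivial: every central simple k-algebra split by the quadric surface function field k(q) is already split over k. -/
open scoped TensorProduct
open Quaternion
set_option synthInstance.maxHeartbeats 1000000
set_option maxHeartbeats 1000000
noncomputable section

universe u v

/-- Upper-triangular coefficient matrix of a quadratic form on `Fin n → R`. -/
def coeffMatrix {R : Type*} [CommRing R] {n : ℕ} (q : QuadraticForm R (Fin n → R)) :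
    Matrix (Fin n) (Fin n) R :=
  Matrix.of fun i j =>
    if i = j then q (Pi.single i 1)
    else if i < j then QuadraticMap.polar q (Pi.single i 1) (Pi.single j 1)
    else 0

/-- Base change of a quadratic form on `Fin n → R` along `R → l`. -/
def extendQF {R : Type*} [CommRing R] {n : ℕ} (q : QuadraticForm R (Fin n → R))
    (l : Type*) [CommRing l] [Algebra R l] : QuadraticForm l (Fin n → l) :=
  ((coeffMatrix q).map (algebraMap R l)).toQuadraticMap'

/-- Gram matrix of the polar bilinear form of `q`. -/
def polarMatrix {R : Type*} [CommRing R] {n : ℕ} (q : QuadraticForm R (Fin n → R)) :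
    Matrix (Fin n) (Fin n) R :=
  Matrix.of fun i j => QuadraticMap.polar q (Pi.single i 1) (Pi.single j 1)

/-- Discriminant: determinant of the Gram matrix (well defined up to squares). -/
def discQF {R : Type*} [CommRing R] {n : ℕ} (q : QuadraticForm R (Fin n → R)) : R :=
  (polarMatrix q).det

/-- Nondegeneracy (char ≠ 2): the Gram determinant is nonzero. -/
def NondegQF {R : Type*} [CommRing R] {n : ℕ} (q : QuadraticForm R (Fin n → R)) : Prop :=
  discQF q ≠ 0

/-- Two quadratic forms are similar if one is isometric to a unit scaling of the other. -/
def SimilarQF {R : Type*} [CommRing R] {n : ℕ} (q q' : QuadraticForm R (Fin n → R)) : Prop :=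
  ∃ c : R, IsUnit c ∧ QuadraticMap.Equivalent (c • q) q'

/-- The polynomial `q(X₁, …, X_{n-1}, 1)` defining the affine quadric. -/
def affineQuadricPoly {R : Type*} [CommRing R] {n : ℕ} (q : QuadraticForm R (Fin n → R)) :
    MvPolynomial (Fin (n - 1)) R :=
  (extendQF q (MvPolynomial (Fin (n - 1)) R))
    (fun i => if h : (i : ℕ) < n - 1 then MvPolynomial.X ⟨i, h⟩ else 1)

/-- Affine coordinate ring `R[x₁,…,x_{n-1}]/(q(x₁,…,x_{n-1},1))` of the quadric. -/
abbrev quadricCoordRing {R : Type*} [CommRing R] {n : ℕ}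
    (q : QuadraticForm R (Fin n → R)) : Type _ :=
  MvPolynomial (Fin (n - 1)) R ⧸ Ideal.span {affineQuadricPoly q}

/-- Function field `k(q)` of the quadric hypersurface `q = 0`. -/
abbrev quadricFunctionField {R : Type*} [CommRing R] {n : ℕ}
    (q : QuadraticForm R (Fin n → R)) : Type _ :=
  FractionRing (quadricCoordRing q)

/-- Affine coordinate ring `k[x,y]/(ax²+by²-1)` of the conic `C_{a,b}`. -/
abbrev conicCoordRing (k : Type*) [Field k] (a b : k) : Type _ :=
  MvPolynomial (Fin 2) k ⧸
    Ideal.span {(MvPolynomial.C a * MvPolynomial.X 0 ^ 2 +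
      MvPolynomial.C b * MvPolynomial.X 1 ^ 2 - 1 : MvPolynomial (Fin 2) k)}

/-- The conic function field `k(C_{a,b})`. -/
abbrev conicFunctionField (k : Type*) [Field k] (a b : k) : Type _ :=
  FractionRing (conicCoordRing k a b)

/-- A `k`-algebra is split if it is isomorphic to a matrix algebra over `k`. -/
def IsSplitAlg (k A : Type*) [Field k] [Ring A] [Algebra k A] : Prop :=
  ∃ n : ℕ, 0 < n ∧ Nonempty (A ≃ₐ[k] Matrix (Fin n) (Fin n) k)

/-- `A` is split by the extension `K/k`: the class of `A` lies in the Brauer kernel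
`κ(K/k) = ker (Br k → Br K)`. -/
def SplitsIn (k : Type*) [Field k] (A : Type*) [Ring A] [Algebra k A]
    (K : Type*) [CommRing K] [Algebra k K] : Prop :=
  ∃ n : ℕ, 0 < n ∧ Nonempty ((K ⊗[k] A) ≃ₐ[K] Matrix (Fin n) (Fin n) K)

/-- Brauer equivalence of two `k`-algebras. -/
def BrauerEquiv (k A B : Type*) [Field k] [Ring A] [Algebra k A] [Ring B] [Algebra k B] :
    Prop :=
  ∃ n m : ℕ, 0 < n ∧ 0 < m ∧
    Nonempty (Matrix (Fin n) (Fin n) A ≃ₐ[k] Matrix (Fin m) (Fin m) B)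

/-- A field is finitely generated (over its prime subfield). -/
def FieldFG (K : Type*) [Field K] : Prop :=
  ∃ s : Finset K, Subfield.closure (s : Set K) = ⊤

/-- Elementary equivalence in the first-order language of rings. -/
def ElemEquivRing (K₁ : Type*) (K₂ : Type*) [CommRing K₁] [CommRing K₂] : Prop :=
  letI := FirstOrder.Ring.compatibleRingOfRing K₁
  letI := FirstOrder.Ring.compatibleRingOfRing K₂
  FirstOrder.Language.ring.ElementarilyEquivalent K₁ K₂

/-- The `m`-fold Pfister form `⟨⟨a₁,…,aₘ⟩⟩ = ⟨1,a₁⟩ ⊗ ⋯ ⊗ ⟨1,aₘ⟩`. -/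
def pfisterForm {k : Type*} [Field k] {m : ℕ} (a : Fin m → k) :
    QuadraticForm k (Fin (2 ^ m) → k) :=
  QuadraticMap.weightedSumSquares k
    (fun j : Fin (2 ^ m) => ∏ i : Fin m, if Nat.testBit (j : ℕ) (i : ℕ) then a i else 1)

section Descent

open Polynomial

theorem isUnit_of_ne_zero_of_finiteDimensional (L : Type*) {E : Type*} [Field L] [Ring E]
    [IsDomain E] [Algebra L E] [FiniteDimensional L E] {a : E} (ha : a ≠ 0) : IsUnit a := by
  let i : DivisionRing E := divisionRingOfFiniteDimensional L E
  exact ⟨⟨a, a⁻¹, mul_inv_cancel₀ ha, inv_mul_cancel₀ ha⟩, rfl⟩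

/-- Right ideals of a polynomial ring over a division ring are principal. -/
theorem exists_generator_of_right_ideal {E : Type*} [Ring E] [IsDomain E]
    (hE : ∀ a : E, a ≠ 0 → IsUnit a) (I : AddSubgroup E[X])
    (hI : ∀ f ∈ I, ∀ g, f * g ∈ I) {f₀ : E[X]} (hf₀ : f₀ ∈ I) (h₀ : f₀ ≠ 0) :
    ∃ u ∈ I, u ≠ 0 ∧ ∀ f ∈ I, ∃ g, f = u * g := by
  obtain ⟨v, ⟨hvI, hv0⟩, hmin⟩ := exists_minimalFor_of_wellFoundedLT
    (fun f : E[X] => f ∈ I ∧ f ≠ 0) degree ⟨f₀, hf₀, h₀⟩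
  obtain ⟨c, hc⟩ := hE v.leadingCoeff (leadingCoeff_ne_zero.2 hv0)
  have hc' : v.leadingCoeff * (↑c⁻¹ : E) = 1 := by rw [← hc]; exact c.mul_inv
  set u := v * C (↑c⁻¹ : E) with hu
  have hmon : u.Monic := monic_mul_C_of_leadingCoeff_mul_eq_one hc'
  have huI : u ∈ I := hI _ hvI _
  have hdeg : u.degree = v.degree := by
    rw [hu, degree_mul, degree_C (c⁻¹).ne_zero, add_zero]
  refine ⟨u, huI, hmon.ne_zero, fun f hf => ⟨f /ₘ u, ?_⟩⟩
  have hdiv := modByMonic_add_div f u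
  have hr : f %ₘ u ∈ I := by
    have : f %ₘ u = f - u * (f /ₘ u) := by rw [eq_sub_iff_add_eq, hdiv]
    rw [this]
    exact I.sub_mem hf (hI _ huI _)
  by_cases h : f %ₘ u = 0
  · rw [h, zero_add] at hdiv
    exact hdiv.symm
  · have h1 := degree_modByMonic_lt f hmon
    rw [hdeg] at h1
    exact absurd (hmin ⟨hr, h⟩ h1.le) (not_le.2 h1)

variable (L E F : Type*) [Field L] [Ring E] [Algebra L E] [Field F] [Algebra L F]
  [Algebra L[X] F] [IsScalarTower L L[X] F]

/-- The canonical map `E[X] → F ⊗ E`, where `F` is an extension of `L[X]`. -/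
def polyToTensor : E[X] →ₐ[L] F ⊗[L] E :=
  ((Algebra.TensorProduct.map (IsScalarTower.toAlgHom L L[X] F) (AlgHom.id L E)).comp
    (Algebra.TensorProduct.comm L E L[X]).toAlgHom).comp (polyEquivTensor L E).toAlgHom

theorem polyToTensor_C (e : E) : polyToTensor L E F (C e) = 1 ⊗ₜ e := by
  simp [polyToTensor, polyEquivTensor_apply]

theorem polyToTensor_map (p : L[X]) :
    polyToTensor L E F (p.map (algebraMap L E)) = algebraMap F _ (algebraMap L[X] F p) := by
  have h : polyEquivTensor L E (p.map (algebraMap L E)) = 1 ⊗ₜ p := by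
    rw [← AlgEquiv.eq_symm_apply, polyEquivTensor_symm_apply_tmul, Polynomial.map, eval₂_eq_sum]
    simp [C_mul_X_pow_eq_monomial]
  simp [polyToTensor, h, Algebra.TensorProduct.algebraMap_apply]

theorem polyToTensor_map_mul_comm (p : L[X]) (z : F ⊗[L] E) :
    polyToTensor L E F (p.map (algebraMap L E)) * z =
      z * polyToTensor L E F (p.map (algebraMap L E)) := by
  rw [polyToTensor_map, Algebra.commutes]

variable [IsFractionRing L[X] F]

theorem polyToTensor_injective : Function.Injective (polyToTensor L E F) := by
  have h : Function.Injective (LinearMap.rTensor E (IsScalarTower.toAlgHom L L[X] F).toLinearMap) :=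
    Module.Flat.rTensor_preserves_injective_linearMap _ (IsFractionRing.injective L[X] F)
  exact (h.comp (Algebra.TensorProduct.comm L E L[X]).injective).comp
    (polyEquivTensor L E).injective

theorem exists_denominator (z : F ⊗[L] E) :
    ∃ c : L[X], c ≠ 0 ∧ ∃ f, algebraMap F _ (algebraMap L[X] F c) * z = polyToTensor L E F f := by
  induction z with
  | zero => exact ⟨1, one_ne_zero, 0, by simp⟩
  | tmul a e =>
    obtain ⟨n, d, hd, rfl⟩ := IsFractionRing.div_surjective (A := L[X]) a
    have hd0 : d ≠ 0 := nonZeroDivisors.ne_zero hd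
    refine ⟨d, hd0, n.map (algebraMap L E) * C e, ?_⟩
    rw [map_mul, polyToTensor_map, polyToTensor_C, Algebra.TensorProduct.algebraMap_apply,
      Algebra.TensorProduct.algebraMap_apply, Algebra.TensorProduct.tmul_mul_tmul,
      Algebra.TensorProduct.tmul_mul_tmul]
    have : algebraMap L[X] F d ≠ 0 := by
      simpa using (IsFractionRing.injective L[X] F).ne hd0
    simp only [Algebra.algebraMap_self, RingHom.id_apply, one_mul, mul_one]
    rw [mul_div_cancel₀ _ this]
  | add x y hx hy =>
    obtain ⟨c, hc, f, hf⟩ := hx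
    obtain ⟨d, hd, g, hg⟩ := hy
    refine ⟨c * d, mul_ne_zero hc hd,
      d.map (algebraMap L E) * f + c.map (algebraMap L E) * g, ?_⟩
    simp only [map_mul, map_add, polyToTensor_map, ← hf, ← hg]
    rw [mul_add, ← mul_assoc, ← mul_assoc, ← map_mul (algebraMap F _), ← map_mul (algebraMap F _),
      mul_comm (algebraMap L[X] F d)]

theorem isDomain_tensor [IsDomain E] : IsDomain (F ⊗[L] E) := by
  have : Nontrivial (F ⊗[L] E) := (polyToTensor_injective L E F).nontrivial
  have key : ∀ c : L[X], c ≠ 0 → IsUnit (algebraMap F (F ⊗[L] E) (algebraMap L[X] F c)) := by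
    intro c hc
    refine RingHom.isUnit_map _ (IsUnit.mk0 _ ?_)
    simpa using (IsFractionRing.injective L[X] F).ne hc
  have : NoZeroDivisors (F ⊗[L] E) := by
    refine ⟨fun {a b} hab => ?_⟩
    obtain ⟨c, hc, f, hf⟩ := exists_denominator L E F a
    obtain ⟨d, hd, g, hg⟩ := exists_denominator L E F b
    have h : polyToTensor L E F (f * g) = 0 := by
      rw [map_mul, ← hf, ← hg, ← mul_assoc, mul_assoc _ a, ← Algebra.commutes, ← mul_assoc,
        mul_assoc, hab, mul_zero]
    rw [map_eq_zero_iff _ (polyToTensor_injective L E F)] at h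
    rcases mul_eq_zero.1 h with rfl | rfl
    · left
      rw [map_zero] at hf
      exact (key c hc).mul_right_eq_zero.1 hf
    · right
      rw [map_zero] at hg
      exact (key d hd).mul_right_eq_zero.1 hg
  exact NoZeroDivisors.to_isDomain _

/-- An element with square in `L[X]` becomes a polynomial after conjugation, in a way compatible
with polynomials anticommuting with it. -/
theorem exists_conj_polynomial [IsDomain E] [FiniteDimensional L E] (θ : F ⊗[L] E) (p : L[X])
    (hθ : θ * θ = algebraMap F _ (algebraMap L[X] F p)) :
    ∃ u : E[X], u ≠ 0 ∧
      (∃ s, θ * polyToTensor L E F u = polyToTensor L E F u * polyToTensor L E F s) ∧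
      ∀ t, polyToTensor L E F t * θ = -(θ * polyToTensor L E F t) → ∃ s, t * u = u * s := by
  have hinj := polyToTensor_injective L E F
  obtain ⟨c, hc, h, hh⟩ := exists_denominator L E F θ
  rw [← polyToTensor_map] at hh hθ
  set φ := polyToTensor L E F with hφ
  set c' := c.map (algebraMap L E) with hc'
  set p' := p.map (algebraMap L E) with hp'
  have hcomm : ∀ z, φ c' * z = z * φ c' := polyToTensor_map_mul_comm L E F c
  have hc0 : c' ≠ 0 := by
    rw [hc']
    exact (Polynomial.map_ne_zero_iff (algebraMap L E).injective).2 hc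
  let I : AddSubgroup E[X] :=
    { carrier := {f | ∃ a b, f = c' * a + h * b}
      zero_mem' := ⟨0, 0, by simp⟩
      add_mem' := by
        rintro _ _ ⟨a, b, rfl⟩ ⟨a', b', rfl⟩
        exact ⟨a + a', b + b', by noncomm_ring⟩
      neg_mem' := by
        rintro _ ⟨a, b, rfl⟩
        exact ⟨-a, -b, by noncomm_ring⟩ }
  have hI : ∀ f ∈ I, ∀ g, f * g ∈ I := by
    rintro _ ⟨a, b, rfl⟩ g
    exact ⟨a * g, b * g, by noncomm_ring⟩
  obtain ⟨u, ⟨a, b, hu⟩, hu0, hgen⟩ := exists_generator_of_right_ideal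
    (fun a ha => isUnit_of_ne_zero_of_finiteDimensional L ha) I hI
    (f₀ := c') ⟨1, 0, by simp⟩ hc0
  refine ⟨u, hu0, ?_, ?_⟩
  · obtain ⟨s, hs⟩ := hgen (c' * (p' * b) + h * a) ⟨p' * b, a, rfl⟩
    refine ⟨s, ?_⟩
    rw [← map_mul φ, ← hs, hu]
    simp only [map_add, map_mul, ← hh]
    calc _ = θ * φ c' * φ a + θ * φ c' * θ * φ b := by noncomm_ring
      _ = φ c' * θ * φ a + φ c' * (θ * θ) * φ b := by rw [← hcomm]; noncomm_ring
      _ = _ := by rw [hθ]; noncomm_ring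
  · intro t ht
    have hth : t * h = -(h * t) := by
      apply hinj
      rw [map_mul, map_neg, map_mul, ← hh, ← mul_assoc, ← hcomm, mul_assoc, ht]
      noncomm_ring
    have htc : t * c' = c' * t := by
      apply hinj
      rw [map_mul, map_mul, hcomm]
    obtain ⟨s, hs⟩ := hgen (c' * (t * a) + h * (-(t * b))) ⟨_, _, rfl⟩
    refine ⟨s, ?_⟩
    rw [← hs, hu, mul_add, ← mul_assoc, htc, ← mul_assoc, hth]
    noncomm_ring

/-- Pairwise anticommuting elements with squares in `L[X]` can be simultaneously conjugated
to polynomials. -/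
theorem exists_simultaneous_conj [IsDomain E] [FiniteDimensional L E] {ι : Type*}
    (θ : ι → F ⊗[L] E) (p : ι → L[X])
    (hθ : ∀ i, θ i * θ i = algebraMap F _ (algebraMap L[X] F (p i)))
    (hanti : ∀ i j, i ≠ j → θ i * θ j = -(θ j * θ i)) (s : Finset ι) :
    ∃ U : F ⊗[L] E, U ≠ 0 ∧ ∀ i ∈ s, ∃ f, θ i * U = U * polyToTensor L E F f := by
  classical
  have := isDomain_tensor L E F
  have hfin : FiniteDimensional F (F ⊗[L] E) := inferInstance
  induction s using Finset.induction_on with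
  | empty => exact ⟨1, one_ne_zero, by simp⟩
  | insert a s ha ih =>
    obtain ⟨U, hU, hs⟩ := ih
    obtain ⟨U, rfl⟩ := isUnit_of_ne_zero_of_finiteDimensional F hU
    obtain ⟨u, hu0, ⟨f, hf⟩, hrest⟩ := exists_conj_polynomial L E F (↑U⁻¹ * θ a * U) (p a) (by
      calc (↑U⁻¹ * θ a * U) * (↑U⁻¹ * θ a * U)
          = ↑U⁻¹ * (θ a * (↑U * ↑U⁻¹) * θ a) * U := by noncomm_ring
        _ = _ := by rw [U.mul_inv, mul_one, hθ, ← Algebra.commutes, mul_assoc, U.inv_mul, mul_one])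
    refine ⟨U * polyToTensor L E F u, mul_ne_zero hU ?_, fun i hi => ?_⟩
    · rwa [Ne, map_eq_zero_iff _ (polyToTensor_injective L E F)]
    · rcases Finset.mem_insert.1 hi with rfl | hi
      · refine ⟨f, ?_⟩
        rw [mul_assoc (U : F ⊗[L] E), ← hf]
        simp only [← mul_assoc, U.mul_inv, one_mul]
      · obtain ⟨t, ht⟩ := hs i hi
        have hne : i ≠ a := fun h => ha (h ▸ hi)
        have ht' : polyToTensor L E F t = ↑U⁻¹ * θ i * U := by
          rw [mul_assoc, ht, ← mul_assoc, U.inv_mul, one_mul]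
        obtain ⟨g, hg⟩ := hrest t (by
          rw [ht']
          calc (↑U⁻¹ * θ i * U) * (↑U⁻¹ * θ a * U)
              = ↑U⁻¹ * (θ i * (↑U * ↑U⁻¹) * θ a) * U := by noncomm_ring
            _ = -(↑U⁻¹ * (θ a * (↑U * ↑U⁻¹) * θ i) * U) := by
              rw [U.mul_inv, mul_one, mul_one, hanti i a hne]; noncomm_ring
            _ = _ := by noncomm_ring)
        refine ⟨g, ?_⟩
        rw [← mul_assoc, ht, mul_assoc, ← map_mul, hg, map_mul, mul_assoc]

/-- `E` contains pairwise anticommuting elements with prescribed scalar squares. -/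
def HasAnticommuting (L E : Type*) [Field L] [Ring E] [Algebra L E] {ι : Type*} (a : ι → L) :
    Prop :=
  ∃ θ : ι → E, (∀ i, θ i * θ i = algebraMap L E (a i)) ∧
    ∀ i j, i ≠ j → θ i * θ j = -(θ j * θ i)

theorem HasAnticommuting.exists_polynomial [IsDomain E] [FiniteDimensional L E] {ι : Type*}
    [Finite ι] {p : ι → L[X]}
    (h : HasAnticommuting F (F ⊗[L] E) fun i => algebraMap L[X] F (p i)) :
    ∃ f : ι → E[X], (∀ i, f i * f i = (p i).map (algebraMap L E)) ∧
      ∀ i j, i ≠ j → f i * f j = -(f j * f i) := by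
  obtain ⟨θ, hθ, hanti⟩ := h
  cases nonempty_fintype ι
  have := isDomain_tensor L E F
  obtain ⟨U, hU, hf⟩ := exists_simultaneous_conj L E F θ p hθ hanti Finset.univ
  choose f hf using fun i => hf i (Finset.mem_univ i)
  have hprod : ∀ i j, U * polyToTensor L E F (f i * f j) = θ i * θ j * U := by
    intro i j
    rw [map_mul, ← mul_assoc, ← hf, mul_assoc, ← hf, mul_assoc]
  refine ⟨f, fun i => ?_, fun i j hij => ?_⟩
  · apply polyToTensor_injective L E F
    apply mul_left_cancel₀ hU
    rw [hprod, hθ, polyToTensor_map, Algebra.commutes]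
  · apply polyToTensor_injective L E F
    apply mul_left_cancel₀ hU
    rw [hprod, hanti i j hij, map_neg, mul_neg, hprod, neg_mul]

theorem HasAnticommuting.descend [IsDomain E] [FiniteDimensional L E] {m : ℕ} {a : Fin m → L}
    {b c : L}
    (h : HasAnticommuting F (F ⊗[L] E)
      (Fin.cons (algebraMap L[X] F (C b * X ^ 2 + C c)) fun i => algebraMap L F (a i) :
        Fin (m + 1) → F)) :
    HasAnticommuting L E (Fin.cons c (Fin.cons b a) : Fin (m + 2) → L) := by
  have h' : HasAnticommuting F (F ⊗[L] E) fun i => algebraMap L[X] F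
      ((Fin.cons (C b * X ^ 2 + C c) fun i => C (a i) : Fin (m + 1) → L[X]) i) := by
    convert h using 1
    funext i
    refine Fin.cases rfl (fun i => ?_) i
    simp only [Fin.cons_succ]
    rw [IsScalarTower.algebraMap_apply L L[X] F, Polynomial.algebraMap_eq]
  obtain ⟨f, hf, hanti⟩ := h'.exists_polynomial L E F
  have hdeg : ∀ i, (f i).natDegree + (f i).natDegree ≤ ((f i) * (f i)).natDegree := by
    intro i
    by_cases h0 : f i = 0
    · simp [h0]
    · rw [natDegree_mul h0 h0]
  have hsucc : ∀ i : Fin m, f i.succ = C ((f i.succ).coeff 0) := by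
    intro i
    apply eq_C_of_natDegree_eq_zero
    have h1 := hdeg i.succ
    rw [hf, Fin.cons_succ, map_C, natDegree_C] at h1
    omega
  have hzero : f 0 = C ((f 0).coeff 1) * X + C ((f 0).coeff 0) := by
    apply eq_X_add_C_of_natDegree_le_one
    have h1 := hdeg 0
    have h2 : (f 0 * f 0).natDegree ≤ 2 := by
      rw [hf, Fin.cons_zero]
      refine natDegree_map_le.trans ?_
      compute_degree
    omega
  set t₁ := (f 0).coeff 1
  set t₀ := (f 0).coeff 0
  set s : Fin m → E := fun i => (f i.succ).coeff 0 with hs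
  have hsq := hf 0
  rw [Fin.cons_zero, hzero] at hsq
  have hexp : (C t₁ * X + C t₀) * (C t₁ * X + C t₀) =
      C (t₁ * t₁) * X ^ 2 + C (t₁ * t₀ + t₀ * t₁) * X + C (t₀ * t₀) := by
    simp only [map_mul, map_add]
    have hX : ∀ g : E[X], X * g = g * X := fun g => X_mul
    simp only [mul_add, add_mul, mul_assoc, hX, sq]
    abel
  rw [hexp] at hsq
  have e0 : t₀ * t₀ = algebraMap L E c := by simpa [coeff_X] using congrArg (coeff · 0) hsq
  have e1 : t₁ * t₀ + t₀ * t₁ = 0 := by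
    simpa [coeff_X, coeff_C, coeff_X_pow, ← C_mul, -map_mul] using congrArg (coeff · 1) hsq
  have e2 : t₁ * t₁ = algebraMap L E b := by
    simpa [coeff_X, coeff_C, coeff_X_pow, ← C_mul, -map_mul] using congrArg (coeff · 2) hsq
  have es : ∀ i, s i * s i = algebraMap L E (a i) := by
    intro i
    have := hf i.succ
    rw [hsucc] at this
    simpa using congrArg (coeff · 0) this
  have ess : ∀ i j, i ≠ j → s i * s j = -(s j * s i) := by
    intro i j hij
    have := hanti i.succ j.succ (by simpa using hij)
    rw [hsucc i, hsucc j] at this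
    simpa using congrArg (coeff · 0) this
  have es0 : ∀ i, s i * t₀ = -(t₀ * s i) := by
    intro i
    have := hanti i.succ 0 (Fin.succ_ne_zero i)
    rw [hsucc i, hzero] at this
    simpa using congrArg (coeff · 0) this
  have es1 : ∀ i, s i * t₁ = -(t₁ * s i) := by
    intro i
    have := hanti i.succ 0 (Fin.succ_ne_zero i)
    rw [hsucc i, hzero] at this
    simpa [coeff_C] using congrArg (coeff · 1) this
  refine ⟨Fin.cons t₀ (Fin.cons t₁ s), ?_, ?_⟩
  · refine Fin.cases e0 (Fin.cases e2 es)
  · intro i j hij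
    induction i using Fin.cases with
    | zero =>
      induction j using Fin.cases with
      | zero => exact absurd rfl hij
      | succ j =>
        induction j using Fin.cases with
        | zero => simpa using eq_neg_of_add_eq_zero_right e1
        | succ j => simp [es0]
    | succ i =>
      induction i using Fin.cases with
      | zero =>
        induction j using Fin.cases with
        | zero => simpa using eq_neg_of_add_eq_zero_left e1
        | succ j =>
          induction j using Fin.cases with
          | zero => exact absurd rfl hij
          | succ j => simp [es1]
      | succ i =>
        induction j using Fin.cases with
        | zero => simpa using es0 i
        | succ j =>
          induction j using Fin.cases with
          | zero => simpa using es1 i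
          | succ j => simpa using ess i j (by simpa using hij)

end Descent

section Quaternion

/-- Three pairwise anticommuting elements of a four-dimensional central division algebra, with
nonzero scalar squares `a`, `b`, `c`, force `-(a * b * c)` to be a square. -/
theorem isSquare_of_hasAnticommuting {k D : Type*} [Field k] (h2 : (2 : k) ≠ 0) [Ring D]
    [IsDomain D] [Algebra k D] [Algebra.IsCentral k D] (hD : Module.finrank k D = 4)
    {a b c : k} (ha : a ≠ 0) (hb : b ≠ 0) (h : HasAnticommuting k D ![c, b, a]) :
    IsSquare (-(a * b * c)) := by
  obtain ⟨θ, hsq, hanti⟩ := h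
  set l := θ 0
  set j := θ 1
  set i := θ 2
  have hi : i * i = algebraMap k D a := hsq 2
  have hj : j * j = algebraMap k D b := hsq 1
  have hl : l * l = algebraMap k D c := hsq 0
  have hji : j * i = -(i * j) := hanti 1 2 (by decide)
  have hli : l * i = -(i * l) := hanti 0 2 (by decide)
  have hlj : l * j = -(j * l) := hanti 0 1 (by decide)
  have h2' : (2 : D) ≠ 0 := by
    intro h0
    apply h2
    apply (algebraMap k D).injective
    rw [map_ofNat, map_zero, h0]
  have hj0 : j ≠ 0 := by
    intro h0
    rw [h0, mul_zero, eq_comm, map_eq_zero_iff _ (algebraMap k D).injective] at hj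
    exact hb hj
  have hi0 : i ≠ 0 := by
    intro h0
    rw [h0, mul_zero, eq_comm, map_eq_zero_iff _ (algebraMap k D).injective] at hi
    exact ha hi
  have hA : ∀ (x : k) (y : D), y * algebraMap k D x = algebraMap k D x * y :=
    fun x y => (Algebra.commutes x y).symm
  have hpair : ∀ x y : k, algebraMap k D x + algebraMap k D y * i = 0 → x = 0 ∧ y = 0 := by
    intro x y hxy
    have h1 : j * (algebraMap k D x + algebraMap k D y * i) =
        (algebraMap k D x - algebraMap k D y * i) * j := by
      rw [mul_add, hA, ← mul_assoc, hA, mul_assoc, hji]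
      noncomm_ring
    rw [hxy, mul_zero, eq_comm, mul_eq_zero, or_iff_left hj0] at h1
    have hx : 2 * algebraMap k D x = 0 := by
      calc 2 * algebraMap k D x = (algebraMap k D x + algebraMap k D y * i) +
            (algebraMap k D x - algebraMap k D y * i) := by noncomm_ring
        _ = 0 := by rw [hxy, h1, add_zero]
    have hx' := (mul_eq_zero.1 hx).resolve_left h2'
    rw [hx', zero_add, mul_eq_zero, or_iff_left hi0] at hxy
    rw [map_eq_zero_iff _ (algebraMap k D).injective] at hx' hxy
    exact ⟨hx', hxy⟩
  have hli4 : LinearIndependent k ![1, i, j, i * j] := by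
    rw [Fintype.linearIndependent_iff]
    intro g hg
    simp only [Fin.sum_univ_four, Algebra.smul_def] at hg
    simp only [Matrix.cons_val_zero, Matrix.cons_val_one, Matrix.cons_val] at hg
    set P := algebraMap k D (g 0) + algebraMap k D (g 1) * i with hP
    set R := algebraMap k D (g 2) + algebraMap k D (g 3) * i with hR
    have hPR : P + R * j = 0 := by
      rw [← hg, hP, hR]; noncomm_ring
    have hPi : i * P = P * i := by
      rw [hP, mul_add, hA, ← mul_assoc, hA]; noncomm_ring
    have hRi : i * R = R * i := by
      rw [hR, mul_add, hA, ← mul_assoc, hA]; noncomm_ring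
    have h1 : i * (P + R * j) = (P - R * j) * i := by
      rw [mul_add, sub_mul, mul_assoc R, hji, hPi, ← mul_assoc, hRi]; noncomm_ring
    rw [hPR, mul_zero, eq_comm, mul_eq_zero, or_iff_left hi0] at h1
    have hP0 : 2 * P = 0 := by
      calc 2 * P = (P + R * j) + (P - R * j) := by noncomm_ring
        _ = 0 := by rw [hPR, h1, add_zero]
    have hP0' := (mul_eq_zero.1 hP0).resolve_left h2'
    rw [hP0', zero_add, mul_eq_zero, or_iff_left hj0] at hPR
    obtain ⟨g0, g1⟩ := hpair _ _ hP0'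
    obtain ⟨g2, g3⟩ := hpair _ _ hPR
    intro n
    fin_cases n <;> assumption
  have hspan := hli4.span_eq_top_of_card_eq_finrank (by simp [hD])
  set w := i * j * l with hw
  have hwi : w * i = i * w := by
    rw [hw, mul_assoc, hli, mul_neg, ← mul_assoc, mul_assoc i j i, hji]; noncomm_ring
  have hwj : w * j = j * w := by
    rw [hw, mul_assoc, hlj, mul_neg, ← mul_assoc, ← mul_assoc, ← mul_assoc, hji]; noncomm_ring
  have hcentral : w ∈ Subalgebra.center k D := by
    rw [Subalgebra.mem_center_iff]
    intro y
    have hy : y ∈ Submodule.span k (Set.range ![1, i, j, i * j]) := hspan ▸ Submodule.mem_top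
    induction hy using Submodule.span_induction with
    | mem x hx =>
      obtain ⟨n, rfl⟩ := hx
      fin_cases n
      · simp
      · exact hwi.symm
      · exact hwj.symm
      · change i * j * w = w * (i * j)
        rw [← mul_assoc w, hwi, mul_assoc i w j, hwj]
        exact mul_assoc _ _ _
    | zero => simp
    | add x y _ _ hx hy => rw [add_mul, mul_add, hx, hy]
    | smul r x _ hx => rw [smul_mul_assoc, mul_smul_comm, hx]
  obtain ⟨r, hr⟩ := Algebra.mem_bot.1 (Algebra.IsCentral.out hcentral)
  refine ⟨r, (algebraMap k D).injective ?_⟩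
  rw [map_mul, hr]
  calc algebraMap k D (-(a * b * c)) = -((i * i) * (j * j) * (l * l)) := by
        rw [hi, hj, hl]; simp
    _ = i * (i * (j * -(j * l))) * l := by noncomm_ring
    _ = i * (i * (j * l)) * j * l := by rw [← hlj]; noncomm_ring
    _ = i * w * j * l := by rw [hw]; noncomm_ring
    _ = w * w := by rw [← hwi, hw]; noncomm_ring

end Quaternion

section Index

/-- A division algebra with a representation of the right size over a quadratic extension
generated by a square root of `p` has degree one, or has degree two and contains a square root
of `p`. -/
theorem degree_le_two_of_quadratic {F K E : Type*} [Field F] [Field K] [Algebra F K]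
    (hK : Module.finrank F K = 2) [Ring E] [IsDomain E] [Algebra F E] [FiniteDimensional F E]
    {n : ℕ} (hn : Module.finrank F E = n ^ 2) (ρ : E →ₐ[F] Module.End K (Fin n → K))
    {p : F} {ω : K} (hω : ω * ω = algebraMap F K p) :
    n = 1 ∨ n = 2 ∧ ∃ θ : E, θ * θ = algebraMap F E p := by
  have hfin : FiniteDimensional F K := Module.finite_of_finrank_pos (by omega)
  have hn0 : 0 < n := by
    have : 0 < Module.finrank F E := Module.finrank_pos
    rw [hn] at this
    exact Nat.pos_of_ne_zero (by rintro rfl; simp at this)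
  have : NeZero n := ⟨hn0.ne'⟩
  have hV : Module.finrank F (Fin n → K) = n * 2 := by
    rw [Module.finrank_pi_fintype]; simp [hK]
  let v : Fin n → K := Pi.single 0 1
  have hv : v ≠ 0 := by simp [v]
  let T : E →ₗ[F] (Fin n → K) :=
    { toFun := fun e => ρ e v
      map_add' := by intros; simp
      map_smul' := by intros; simp }
  have hT : Function.Injective T := by
    rw [injective_iff_map_eq_zero]
    intro e he
    by_contra h0
    obtain ⟨u, rfl⟩ := isUnit_of_ne_zero_of_finiteDimensional F h0
    apply hv
    calc v = ρ (↑u⁻¹ * ↑u) v := by simp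
      _ = ρ ↑u⁻¹ (T u) := by rw [map_mul]; rfl
      _ = 0 := by rw [he, map_zero]
  have hle := LinearMap.finrank_le_finrank_of_injective hT
  rw [hn, hV, sq] at hle
  have hle' := Nat.le_of_mul_le_mul_left hle hn0
  rcases (by omega : n = 1 ∨ n = 2) with h | h
  · exact Or.inl h
  · refine Or.inr ⟨h, ?_⟩
    have hsurj : Function.Surjective T := by
      rwa [← LinearMap.injective_iff_surjective_of_finrank_eq_finrank]
      rw [hn, hV, h, sq]
    obtain ⟨θ, hθ⟩ := hsurj (ω • v)
    refine ⟨θ, hT ?_⟩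
    have hθ' : ρ θ v = ω • v := hθ
    change ρ (θ * θ) v = ρ (algebraMap F E p) v
    rw [map_mul, Module.End.mul_apply, hθ', map_smul, hθ', smul_smul, hω, AlgHom.commutes,
      Module.algebraMap_end_apply, algebraMap_smul]

/-- A representation of a matrix algebra over `D` is a power of a representation of `D`. -/
theorem exists_representation_of_matrix {k K D : Type*} [Field k] [Field K] [Algebra k K]
    [Ring D] [Algebra k D] {r n : ℕ} [NeZero r]
    (ψ : Matrix (Fin r) (Fin r) D →ₐ[k] Module.End K (Fin n → K)) :
    ∃ (m : ℕ) (_ : D →ₐ[k] Module.End K (Fin m → K)), n = r * m := by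
  let e : Fin r → Fin r → D → Module.End K (Fin n → K) := fun i j d => ψ (Matrix.single i j d)
  have hmul : ∀ i j l d d', e i j d * e j l d' = e i l (d * d') := by
    intro i j l d d'
    simp only [e, ← map_mul, Matrix.single_mul_single_same]
  have hadd : ∀ i j d d', e i j (d + d') = e i j d + e i j d' := by
    intro i j d d'
    simp only [e, ← map_add, Matrix.single_add]
  have hsum : ∑ i, e i i 1 = 1 := by
    simp only [e, ← map_sum]
    rw [← map_one ψ]
    congr 1
    ext a b
    rw [Matrix.sum_apply, Finset.sum_eq_single a]
    · simp [Matrix.single_apply, Matrix.one_apply]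
    · intro i _ hi
      simp [hi]
    · simp
  let W : Submodule K (Fin n → K) := LinearMap.range (e 0 0 1)
  have hW : ∀ x ∈ W, e 0 0 1 x = x := by
    rintro _ ⟨y, rfl⟩
    rw [← Module.End.mul_apply, hmul, one_mul]
  have hmem : ∀ j d x, e 0 j d x ∈ W := by
    intro j d x
    refine ⟨e 0 j d x, ?_⟩
    rw [← Module.End.mul_apply, hmul, one_mul]
  let ρ : D →ₐ[k] Module.End K W :=
    { toFun := fun d => (e 0 0 d).restrict fun x _ => hmem 0 d x
      map_one' := by
        ext1 x
        exact Subtype.ext (hW x x.2)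
      map_mul' := by
        intro d d'
        ext1 x
        apply Subtype.ext
        change e 0 0 (d * d') x = e 0 0 d (e 0 0 d' x)
        rw [← hmul 0 0 0, Module.End.mul_apply]
      map_zero' := by
        ext1 x
        apply Subtype.ext
        change e 0 0 0 x = 0
        simp [e]
      map_add' := by
        intro d d'
        ext1 x
        apply Subtype.ext
        change e 0 0 (d + d') x = e 0 0 d x + e 0 0 d' x
        rw [hadd, LinearMap.add_apply]
      commutes' := by
        intro c
        ext1 x
        apply Subtype.ext
        change e 0 0 (algebraMap k D c) x = c • (x : Fin n → K)
        have : e 0 0 (algebraMap k D c) = c • e 0 0 1 := by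
          simp only [e, ← map_smul, Matrix.smul_single, Algebra.algebraMap_eq_smul_one]
        rw [this, LinearMap.smul_apply, hW x x.2] }
  let T : (Fin n → K) ≃ₗ[K] (Fin r → W) :=
    { toFun := fun x i => ⟨e 0 i 1 x, hmem i 1 x⟩
      invFun := fun y => ∑ i, e i 0 1 (y i)
      map_add' := by
        intro x y
        funext i
        apply Subtype.ext
        simp
      map_smul' := by
        intro c x
        funext i
        apply Subtype.ext
        simp
      left_inv := by
        intro x
        simp only [← Module.End.mul_apply, hmul, one_mul]
        rw [← LinearMap.sum_apply, hsum, Module.End.one_apply]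
      right_inv := by
        intro y
        funext i
        apply Subtype.ext
        simp only [map_sum, ← Module.End.mul_apply]
        rw [Finset.sum_eq_single i]
        · rw [hmul, one_mul, hW _ (y i).2]
        · intro j _ hji
          have : e 0 i 1 * e j 0 1 = 0 := by
            simp only [e, ← map_mul]
            rw [Matrix.single_mul_single_of_ne _ _ _ _ hji.symm, map_zero]
          rw [this, LinearMap.zero_apply]
        · simp }
  refine ⟨Module.finrank K W,
    (((Module.finBasis K W).equivFun.conjAlgEquiv k).toAlgHom).comp ρ, ?_⟩
  have := T.finrank_eq
  simpa [Module.finrank_pi_fintype] using this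

end Index

section Quadric

theorem polarMatrix_eq {k : Type*} [Field k] {n : ℕ} (q : QuadraticForm k (Fin n → k)) :
    polarMatrix q = coeffMatrix q + (coeffMatrix q).transpose := by
  ext i j
  simp only [polarMatrix, coeffMatrix, Matrix.of_apply, Matrix.add_apply, Matrix.transpose_apply]
  rcases lt_trichotomy i j with h | rfl | h
  · simp [h.ne, h.ne', h, h.not_gt]
  · simp [two_mul]
  · simp [h.ne, h.ne', h, h.not_gt, QuadraticMap.polar_comm]

theorem extendQF_apply {R : Type*} [CommRing R] {n : ℕ} (q : QuadraticForm R (Fin n → R))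
    (S : Type*) [CommRing S] [Algebra R S] (v : Fin n → S) :
    extendQF q S v = v ⬝ᵥ ((coeffMatrix q).map (algebraMap R S)).mulVec v := by
  rw [extendQF, Matrix.toQuadraticMap', Matrix.toQuadraticForm',
    LinearMap.BilinMap.toQuadraticMap_apply, Matrix.toLinearMap₂'_apply']

theorem two_mul_extendQF {k : Type*} [Field k] {n : ℕ} (q : QuadraticForm k (Fin n → k))
    (S : Type*) [CommRing S] [Algebra k S] (v : Fin n → S) :
    2 * extendQF q S v = v ⬝ᵥ ((polarMatrix q).map (algebraMap k S)).mulVec v := by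
  rw [extendQF_apply, polarMatrix_eq, Matrix.map_add _ (map_add _), Matrix.add_mulVec,
    dotProduct_add, two_mul, Matrix.transpose_map, Matrix.mulVec_transpose,
    dotProduct_comm v (Matrix.vecMul _ _),
    ← Matrix.dotProduct_mulVec]

/-- Diagonalization of a nondegenerate quadratic form, valid after arbitrary base change. -/
theorem exists_diagonalization {k : Type u} [Field k] (h2 : (2 : k) ≠ 0) {n : ℕ}
    (q : QuadraticForm k (Fin n → k)) (hq : NondegQF q) :
    ∃ (N M : Matrix (Fin n) (Fin n) k) (w : Fin n → k), N * M = 1 ∧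
      (∀ i, w i ≠ 0) ∧ discQF q * N.det ^ 2 = 2 ^ n * ∏ i, w i ∧
      ∀ (S : Type u) [CommRing S] [Algebra k S] (v : Fin n → S),
        extendQF q S ((N.map (algebraMap k S)).mulVec v) =
          ∑ i, algebraMap k S (w i) * v i ^ 2 := by
  let _ : Invertible (2 : k) := invertibleOfNonzero h2
  have hP : ∀ q' : QuadraticForm k (Fin n → k), polarMatrix q' = (2 : k) • q'.toMatrix' := by
    intro q'
    ext i j
    simp [polarMatrix, QuadraticForm.toMatrix', LinearMap.toMatrix₂'_apply,
      QuadraticMap.associated_apply, QuadraticMap.polar, mul_inv_cancel_left₀ h2]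
  have hsep : LinearMap.SeparatingLeft (QuadraticMap.associated q) := by
    apply LinearMap.separatingLeft_of_det_ne_zero (Pi.basisFun k (Fin n))
    intro h0
    apply hq
    have h1 : (QuadraticForm.toMatrix (Pi.basisFun k (Fin n)) q).det = 0 := h0
    rw [QuadraticForm.toMatrix_eq_toMatrix'] at h1
    rw [discQF, hP, Matrix.det_smul, h1, mul_zero]
  obtain ⟨w, ⟨f⟩⟩ := QuadraticForm.equivalent_weightedSumSquares_units_of_nondegenerate' q hsep
  have hdim : Module.finrank k (Fin n → k) = n := by simp
  generalize Module.finrank k (Fin n → k) = m at w f hdim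
  subst hdim
  set N := LinearMap.toMatrix' (f.symm.toLinearEquiv : (Fin m → k) →ₗ[k] (Fin m → k)) with hN
  have hcomp : q.comp (f.symm.toLinearEquiv : (Fin m → k) →ₗ[k] (Fin m → k)) =
      QuadraticMap.weightedSumSquares k w := by
    ext v
    exact f.symm.map_app v
  have hdiag : polarMatrix (QuadraticMap.weightedSumSquares k w) =
      Matrix.diagonal fun i => 2 * (w i : k) := by
    ext i j
    simp only [polarMatrix, Matrix.of_apply, QuadraticMap.polar,
      QuadraticMap.weightedSumSquares_apply, Matrix.diagonal_apply, ← Finset.sum_sub_distrib]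
    have : ∀ a, w a • ((Pi.single i 1 + Pi.single j 1 : Fin m → k) a *
        (Pi.single i 1 + Pi.single j 1 : Fin m → k) a) -
        w a • ((Pi.single i 1 : Fin m → k) a * (Pi.single i 1 : Fin m → k) a) -
        w a • ((Pi.single j 1 : Fin m → k) a * (Pi.single j 1 : Fin m → k) a) =
        if a = i then (if i = j then 2 * (w i : k) else 0) else 0 := by
      intro a
      simp only [Units.smul_def, smul_eq_mul, Pi.add_apply, Pi.single_apply]
      split_ifs <;> simp_all
      ring
    rw [Finset.sum_congr rfl fun a _ => this a]
    simp
  have hgram : N.transpose * polarMatrix q * N = Matrix.diagonal fun i => 2 * (w i : k) := by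
    rw [← hdiag, ← hcomp, hP, hP, QuadraticForm.toMatrix'_comp, Matrix.mul_smul, Matrix.smul_mul]
  refine ⟨N, LinearMap.toMatrix' (f.toLinearEquiv : (Fin m → k) →ₗ[k] (Fin m → k)),
    fun i => w i, ?_, fun i => (w i).ne_zero, ?_, ?_⟩
  · rw [hN, ← LinearMap.toMatrix'_comp, ← LinearMap.toMatrix'_id]
    congr 1
    exact LinearMap.ext f.toLinearEquiv.symm_apply_apply
  · have := congrArg Matrix.det hgram
    rw [Matrix.det_mul, Matrix.det_mul, Matrix.det_transpose, Matrix.det_diagonal,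
      Finset.prod_mul_distrib] at this
    simp only [Finset.prod_const, Finset.card_univ, Fintype.card_fin] at this
    rw [← this, discQF]
    ring
  · intro S _ _ v
    have h2S : IsUnit (2 : S) := by
      simpa only [map_ofNat] using (IsUnit.mk0 _ h2).map (algebraMap k S)
    apply h2S.mul_left_cancel
    rw [two_mul_extendQF, Matrix.mulVec_mulVec, Matrix.dotProduct_mulVec, Matrix.vecMul_mulVec,
      ← Matrix.dotProduct_mulVec, ← Matrix.transpose_map, ← Matrix.map_mul, ← Matrix.map_mul,
      ← Matrix.mul_assoc, hgram, Matrix.diagonal_map (map_zero _), Finset.mul_sum]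
    simp only [dotProduct, Matrix.mulVec_diagonal, map_mul, map_ofNat]
    refine Finset.sum_congr rfl fun i _ => ?_
    ring

end Quadric

section Tower

open Polynomial

theorem AlgebraicIndependent.cons_X {k L F : Type*} [Field k] [Field L] [Field F] [Algebra k L]
    [Algebra k F] [Algebra L F] [IsScalarTower k L F] [Algebra L[X] F] [IsScalarTower L L[X] F]
    [IsFractionRing L[X] F] {n : ℕ} {g : Fin n → L} (hg : AlgebraicIndependent k g) :
    AlgebraicIndependent k
      (Fin.cons (algebraMap L[X] F X) fun i => algebraMap L F (g i) : Fin (n + 1) → F) := by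
  have : IsScalarTower k L[X] F := IsScalarTower.of_algebraMap_eq fun x => by
    rw [IsScalarTower.algebraMap_apply k L F, IsScalarTower.algebraMap_apply L L[X] F,
      IsScalarTower.algebraMap_apply k L L[X]]
  have heq : MvPolynomial.aeval (Fin.cons (algebraMap L[X] F X) fun i => algebraMap L F (g i)) =
      ((IsScalarTower.toAlgHom k L[X] F).comp (mapAlgHom (MvPolynomial.aeval g))).comp
        (MvPolynomial.finSuccEquiv k n).toAlgHom := by
    ext i
    induction i using Fin.cases with
    | zero => simp [MvPolynomial.finSuccEquiv_X_zero]
    | succ i =>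
      simp [MvPolynomial.finSuccEquiv_X_succ, IsScalarTower.algebraMap_apply L L[X] F]
  rw [AlgebraicIndependent, heq]
  exact ((IsFractionRing.injective L[X] F).comp (map_injective _ hg)).comp
    (MvPolynomial.finSuccEquiv k n).injective

theorem not_isSquare_quadratic {L F : Type*} [Field L] (h2 : (2 : L) ≠ 0) [Field F]
    [Algebra L[X] F] [IsFractionRing L[X] F] {b c : L} (hb : b ≠ 0) (hc : c ≠ 0) :
    ¬IsSquare (algebraMap L[X] F (C b * X ^ 2 + C c)) := by
  rintro ⟨y, hy⟩
  obtain ⟨f, rfl⟩ := IsIntegrallyClosed.exists_algebraMap_eq_of_isIntegral_pow (R := L[X])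
    (x := y) (n := 2) two_pos (by rw [sq, ← hy]; exact isIntegral_algebraMap)
  rw [← map_mul] at hy
  have hf := (IsFractionRing.injective L[X] F hy).symm
  have h0 : f ≠ 0 := by
    rintro rfl
    have := congrArg (coeff · 0) hf
    simp at this
    exact hc this.symm
  have hdeg : f.natDegree ≤ 1 := by
    have h1 : (f * f).natDegree ≤ 2 := by
      rw [hf]
      compute_degree
    rw [natDegree_mul h0 h0] at h1
    omega
  rw [eq_X_add_C_of_natDegree_le_one hdeg] at hf
  set s := f.coeff 1
  set t := f.coeff 0
  have hexp : (C s * X + C t) * (C s * X + C t) =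
      C (s * s) * X ^ 2 + C (2 * (s * t)) * X + C (t * t) := by
    simp only [map_mul, map_ofNat]
    ring
  rw [hexp] at hf
  have e0 : t * t = c := by simpa [coeff_X] using congrArg (coeff · 0) hf
  have e1 : s = 0 ∨ t = 0 := by
    simpa [coeff_X, coeff_C, coeff_X_pow, ← C_mul, -map_mul, h2] using congrArg (coeff · 1) hf
  have e2 : s * s = b := by
    simpa [coeff_X, coeff_C, coeff_X_pow, ← C_mul, -map_mul] using congrArg (coeff · 2) hf
  rcases e1 with h | h
  · exact hb (by rw [← e2, h, mul_zero])
  · exact hc (by rw [← e0, h, mul_zero])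

/-- The ideal of relations between algebraically independent elements and a square root `ω`
of a non-square is generated by the equation of `ω`. -/
theorem dvd_of_aeval_cons_eq_zero {k F K : Type*} [Field k] [Field F] [Field K] [Algebra k F]
    [Algebra k K] [Algebra F K] [IsScalarTower k F K] {n : ℕ} {g : Fin n → F}
    (hg : AlgebraicIndependent k g) (P : MvPolynomial (Fin n) k)
    (hP : ¬IsSquare (MvPolynomial.aeval g P)) {ω : K}
    (hω : ω * ω = algebraMap F K (MvPolynomial.aeval g P)) (H : MvPolynomial (Fin (n + 1)) k)
    (hH : MvPolynomial.aeval (Fin.cons ω fun i => algebraMap F K (g i) : Fin (n + 1) → K) H = 0) :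
    (MvPolynomial.X 0 ^ 2 - MvPolynomial.rename Fin.succ P) ∣ H := by
  set e := MvPolynomial.finSuccEquiv k n
  have heC : e (MvPolynomial.rename Fin.succ P) = C P := by
    have : (e.toAlgHom.comp (MvPolynomial.rename Fin.succ)) = CAlgHom := by
      ext i
      simp [e, MvPolynomial.finSuccEquiv_X_succ]
    exact DFunLike.congr_fun this P
  have heX : e (MvPolynomial.X 0) = X := MvPolynomial.finSuccEquiv_X_zero
  let ev : (MvPolynomial (Fin n) k)[X] →+* K :=
    eval₂RingHom ((algebraMap F K).comp (MvPolynomial.aeval g).toRingHom) ω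
  have hev : ∀ h, MvPolynomial.aeval (Fin.cons ω fun i => algebraMap F K (g i) : Fin (n + 1) → K) h
      = ev (e h) := by
    intro h
    have : (MvPolynomial.aeval
        (Fin.cons ω fun i => algebraMap F K (g i) : Fin (n + 1) → K)).toRingHom =
        ev.comp e.toAlgHom.toRingHom := by
      apply MvPolynomial.ringHom_ext
      · intro r
        simp [ev, e, MvPolynomial.finSuccEquiv_apply, IsScalarTower.algebraMap_apply k F K]
      · intro i
        induction i using Fin.cases with
        | zero => simp [ev, e, MvPolynomial.finSuccEquiv_X_zero]
        | succ i => simp [ev, e, MvPolynomial.finSuccEquiv_X_succ]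
    exact DFunLike.congr_fun this h
  have hmon : (X ^ 2 - C P).Monic := monic_X_pow_sub_C P two_ne_zero
  have hdiv := modByMonic_add_div (e H) (X ^ 2 - C P)
  set r := e H %ₘ (X ^ 2 - C P) with hr
  have hdeg : r.natDegree ≤ 1 := by
    have := natDegree_modByMonic_lt (e H) hmon (by
      intro h1
      have := congrArg natDegree h1
      rw [natDegree_X_pow_sub_C] at this
      simp at this)
    rw [natDegree_X_pow_sub_C, ← hr] at this
    omega
  have hr1 := eq_X_add_C_of_natDegree_le_one hdeg
  have hevr : ev r = 0 := by
    have h1 : ev (X ^ 2 - C P) = 0 := by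
      simp [ev, sq, hω]
    have h3 := congrArg ev hdiv
    rwa [map_add, map_mul, h1, zero_mul, add_zero, ← hev, hH] at h3
  have hlin : algebraMap F K (MvPolynomial.aeval g (r.coeff 1)) * ω +
      algebraMap F K (MvPolynomial.aeval g (r.coeff 0)) = 0 := by
    rw [hr1] at hevr
    simpa [ev] using hevr
  have hinj := (algebraMap F K).injective
  have h1 : MvPolynomial.aeval g (r.coeff 1) = 0 := by
    by_contra hne
    apply hP
    refine ⟨MvPolynomial.aeval g (r.coeff 0) / MvPolynomial.aeval g (r.coeff 1), hinj ?_⟩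
    have hne' : algebraMap F K (MvPolynomial.aeval g (r.coeff 1)) ≠ 0 :=
      (map_ne_zero_iff _ hinj).2 hne
    rw [map_mul, map_div₀, ← hω]
    have : ω = -(algebraMap F K (MvPolynomial.aeval g (r.coeff 0)) /
        algebraMap F K (MvPolynomial.aeval g (r.coeff 1))) := by
      field_simp
      linear_combination hlin
    rw [this]
    ring
  have h0 : MvPolynomial.aeval g (r.coeff 0) = 0 := by
    rw [h1, map_zero, zero_mul, zero_add] at hlin
    exact hinj (by rw [hlin, map_zero])
  rw [map_eq_zero_iff _ hg] at h0 h1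
  rw [hr1, h0, h1, map_zero, zero_mul, zero_add, zero_add] at hdiv
  rw [← map_dvd_iff e, map_sub, map_pow, heX, heC, ← hdiv]
  exact dvd_mul_right _ _

/-- A division algebra split by the function field of a quadric surface, presented as a tower,
has degree at most two. -/
theorem index_of_tower {k F₁ F₂ F₃ K D : Type*} [Field k] [Field F₁] [Field F₂] [Field F₃] [Field K]
    [Algebra k F₁] [Algebra k[X] F₁] [IsScalarTower k k[X] F₁] [IsFractionRing k[X] F₁]
    [Algebra F₁ F₂] [Algebra F₁[X] F₂] [IsScalarTower F₁ F₁[X] F₂] [IsFractionRing F₁[X] F₂]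
    [Algebra F₂ F₃] [Algebra F₂[X] F₃] [IsScalarTower F₂ F₂[X] F₃] [IsFractionRing F₂[X] F₃]
    [Algebra k K] [Algebra F₁ K] [Algebra F₂ K] [Algebra F₃ K] [IsScalarTower k F₁ K]
    [IsScalarTower F₁ F₂ K] [IsScalarTower F₂ F₃ K] (hK : Module.finrank F₃ K = 2) (a b c : k)
    {ω : K} (hω : ω * ω = algebraMap F₃ K (algebraMap F₂[X] F₃
      (C (algebraMap F₁ F₂ (algebraMap k F₁ a)) * X ^ 2 + C (algebraMap F₁[X] F₂
        (C (algebraMap k F₁ b) * X ^ 2 + C (algebraMap k[X] F₁ (C c * X ^ 2 + C 0)))))))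
    [Ring D] [IsDomain D] [Algebra k D] [FiniteDimensional k D] {n : ℕ}
    (hn : Module.finrank k D = n ^ 2) (ρ : D →ₐ[k] Module.End K (Fin n → K)) :
    n = 1 ∨ n = 2 ∧ HasAnticommuting k D ![0, c, b, a] := by
  have := isDomain_tensor k D F₁
  have := isDomain_tensor F₁ (F₁ ⊗[k] D) F₂
  have := isDomain_tensor F₂ (F₂ ⊗[F₁] (F₁ ⊗[k] D)) F₃
  let ρ₁ : F₁ ⊗[k] D →ₐ[F₁] Module.End K (Fin n → K) :=
    Algebra.TensorProduct.lift (Algebra.ofId F₁ _) ρ fun x y => Algebra.commutes x (ρ y)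
  let ρ₂ : F₂ ⊗[F₁] (F₁ ⊗[k] D) →ₐ[F₂] Module.End K (Fin n → K) :=
    Algebra.TensorProduct.lift (Algebra.ofId F₂ _) ρ₁ fun x y => Algebra.commutes x (ρ₁ y)
  let ρ₃ : F₃ ⊗[F₂] (F₂ ⊗[F₁] (F₁ ⊗[k] D)) →ₐ[F₃] Module.End K (Fin n → K) :=
    Algebra.TensorProduct.lift (Algebra.ofId F₃ _) ρ₂ fun x y => Algebra.commutes x (ρ₂ y)
  have hn₃ : Module.finrank F₃ (F₃ ⊗[F₂] (F₂ ⊗[F₁] (F₁ ⊗[k] D))) = n ^ 2 := by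
    rw [Module.finrank_baseChange, Module.finrank_baseChange, Module.finrank_baseChange, hn]
  rcases degree_le_two_of_quadratic (E := F₃ ⊗[F₂] (F₂ ⊗[F₁] (F₁ ⊗[k] D))) hK hn₃ ρ₃ hω with
    h | ⟨h, θ, hθ⟩
  · exact Or.inl h
  refine Or.inr ⟨h, ?_⟩
  have h₃ : HasAnticommuting F₂ (F₂ ⊗[F₁] (F₁ ⊗[k] D))
      (Fin.cons (algebraMap F₁[X] F₂ (C (algebraMap k F₁ b) * X ^ 2 +
        C (algebraMap k[X] F₁ (C c * X ^ 2 + C 0))))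
        fun i => algebraMap F₁ F₂ (![algebraMap k F₁ a] i) : Fin 2 → F₂) := by
    convert HasAnticommuting.descend F₂ (F₂ ⊗[F₁] (F₁ ⊗[k] D)) F₃ (m := 0) (a := ![])
      (b := algebraMap F₁ F₂ (algebraMap k F₁ a)) (c := algebraMap F₁[X] F₂
        (C (algebraMap k F₁ b) * X ^ 2 + C (algebraMap k[X] F₁ (C c * X ^ 2 + C 0))))
      ⟨fun _ => θ, ?_, ?_⟩ using 1
    · funext i
      fin_cases i <;> rfl
    · intro i
      fin_cases i
      exact hθ
    · intro i j hij
      exact absurd (Subsingleton.elim (α := Fin 1) i j) hij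
  have h₂ : HasAnticommuting F₁ (F₁ ⊗[k] D)
      (Fin.cons (algebraMap k[X] F₁ (C c * X ^ 2 + C 0))
        fun i => algebraMap k F₁ (![b, a] i) : Fin 3 → F₁) := by
    convert HasAnticommuting.descend F₁ (F₁ ⊗[k] D) F₂ (m := 1) h₃ using 1
    funext i
    fin_cases i <;> rfl
  exact HasAnticommuting.descend k D F₁ (m := 2) h₂

end Tower

section Embedding

open MvPolynomial

theorem map_extendQF {R S T : Type*} [CommRing R] [CommRing S] [CommRing T] [Algebra R S]
    [Algebra R T] (f : S →ₐ[R] T) {n : ℕ} (q : QuadraticForm R (Fin n → R)) (v : Fin n → S) :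
    f (extendQF q S v) = extendQF q T fun i => f (v i) := by
  simp only [extendQF_apply, dotProduct, Matrix.mulVec, map_sum, map_mul, Matrix.map_apply,
    AlgHom.commutes]

/-- The dehomogenization at the last coordinate. -/
def affinePoint (k : Type*) [CommRing k] (n : ℕ) : Fin n → MvPolynomial (Fin (n - 1)) k :=
  fun i => if h : (i : ℕ) < n - 1 then X ⟨i, h⟩ else 1

theorem aeval_affinePoint {k S : Type*} [CommRing k] [CommRing S] [Algebra k S] {n : ℕ}
    (s : Fin (n + 1) → S) (hs : s (Fin.last n) = 1) (i : Fin (n + 1)) :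
    aeval (fun j : Fin n => s j.castSucc) (affinePoint k (n + 1) i) = s i := by
  induction i using Fin.lastCases with
  | last => simp [affinePoint, hs]
  | cast i =>
    have h : (i.castSucc : ℕ) < n + 1 - 1 := i.2
    rw [affinePoint, dif_pos h, aeval_X]
    rfl

theorem exists_homogenization {k K : Type*} [Field k] [Field K] [Algebra k K] {n : ℕ}
    (u : Fin (n + 1) → K) (hu : u (Fin.last n) ≠ 0) (g : MvPolynomial (Fin n) k) :
    ∃ (m : ℕ) (G : MvPolynomial (Fin (n + 1)) k), aeval (affinePoint k (n + 1)) G = g ∧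
      aeval u G = u (Fin.last n) ^ m *
        aeval (fun j : Fin n => u j.castSucc / u (Fin.last n)) g := by
  have hlast : aeval (affinePoint k (n + 1)) (X (Fin.last n) : MvPolynomial (Fin (n + 1)) k) =
      1 := by
    simp [affinePoint]
  induction g using MvPolynomial.induction_on with
  | C a => exact ⟨0, C a, by simp, by simp⟩
  | add p q hp hq =>
    obtain ⟨m, G, h1, h2⟩ := hp
    obtain ⟨m', G', h1', h2'⟩ := hq
    refine ⟨m + m', X (Fin.last n) ^ m' * G + X (Fin.last n) ^ m * G', ?_, ?_⟩
    · rw [map_add, map_mul, map_mul, map_pow, map_pow, hlast, h1, h1', one_pow, one_pow, one_mul,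
        one_mul]
    · rw [map_add, map_mul, map_mul, map_pow, map_pow, h2, h2', aeval_X, map_add]
      ring
  | mul_X p i hp =>
    obtain ⟨m, G, h1, h2⟩ := hp
    refine ⟨m + 1, G * X i.castSucc, ?_, ?_⟩
    · rw [map_mul, h1, aeval_X]
      congr 1
      exact dif_pos i.2
    · rw [map_mul, h2, map_mul, aeval_X, aeval_X]
      field_simp
      ring

/-- A generic zero of a diagonalized form is a generic point of the quadric. -/
theorem exists_injective_of_generic_zero {k K : Type u} [Field k] [Field K] [Algebra k K] {n : ℕ}
    (q : QuadraticForm k (Fin (n + 1) → k)) {N M : Matrix (Fin (n + 1)) (Fin (n + 1)) k}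
    (hNM : N * M = 1) {w : Fin (n + 1) → k} (hw : w 0 ≠ 0)
    (hext : ∀ (S : Type u) [CommRing S] [Algebra k S] (v : Fin (n + 1) → S),
      extendQF q S ((N.map (algebraMap k S)).mulVec v) = ∑ i, algebraMap k S (w i) * v i ^ 2)
    {v : Fin (n + 1) → K} (hv : ∑ i, algebraMap k K (w i) * v i ^ 2 = 0)
    (hgen : ∀ H : MvPolynomial (Fin (n + 1)) k, aeval v H = 0 → (∑ i, C (w i) * X i ^ 2) ∣ H) :
    ∃ φ : quadricCoordRing q →ₐ[k] K, Function.Injective φ := by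
  let P := MvPolynomial (Fin n) k
  let d : Fin (n + 1) → P := affinePoint k (n + 1)
  set u := (N.map (algebraMap k K)).mulVec v with hu
  let ℓ : Fin (n + 1) → MvPolynomial (Fin (n + 1)) k := fun i => ∑ j, C (N i j) * X j
  have hℓ : ∀ i, aeval v (ℓ i) = u i := by
    intro i
    simp [ℓ, hu, Matrix.mulVec, dotProduct]
  have hquad : ∀ {S : Type u} [CommRing S] [Algebra k S] (s : Fin (n + 1) → S),
      aeval s (∑ i, C (w i) * X i ^ 2 : MvPolynomial (Fin (n + 1)) k) =
        extendQF q S ((N.map (algebraMap k S)).mulVec s) := by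
    intro S _ _ s
    simp [hext]
  have hu0 : u (Fin.last n) ≠ 0 := by
    intro h0
    have hℓ0 : ℓ (Fin.last n) ≠ 0 := by
      intro h
      have h1 := congrArg (aeval fun j => M j (Fin.last n)) h
      have h2 := congrFun (congrFun hNM (Fin.last n)) (Fin.last n)
      simp [ℓ] at h1
      rw [Matrix.mul_apply, h1, Matrix.one_apply_eq] at h2
      exact zero_ne_one h2
    obtain ⟨R, hR⟩ := hgen (ℓ (Fin.last n)) (by rw [hℓ, h0])
    have hS0 : (∑ i, C (w i) * X i ^ 2 : MvPolynomial (Fin (n + 1)) k) ≠ 0 := by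
      intro h
      rw [h, zero_mul] at hR
      exact hℓ0 hR
    have hR0 : R ≠ 0 := by
      rintro rfl
      exact hℓ0 (by rw [hR, mul_zero])
    have hdeg := congrArg totalDegree hR
    rw [totalDegree_mul_of_isDomain hS0 hR0] at hdeg
    have h1 : (ℓ (Fin.last n)).totalDegree ≤ 1 := by
      refine totalDegree_finsetSum_le fun j _ => (totalDegree_mul _ _).trans ?_
      simp
    have h2 : 2 ≤ (∑ i, C (w i) * X i ^ 2 : MvPolynomial (Fin (n + 1)) k).totalDegree := by
      have hmem : Finsupp.single (0 : Fin (n + 1)) 2 ∈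
          (∑ i, C (w i) * X i ^ 2 : MvPolynomial (Fin (n + 1)) k).support := by
        rw [mem_support_iff, coeff_sum, Finset.sum_eq_single 0]
        · simpa [coeff_C_mul, coeff_X_pow] using hw
        · intro j _ hj
          rw [coeff_C_mul, coeff_X_pow, if_neg, mul_zero]
          intro h
          exact hj ((Finsupp.single_left_inj two_ne_zero).1 h)
        · simp
      have := le_totalDegree hmem
      simpa using this
    omega
  let φ₀ : P →ₐ[k] K := aeval fun j : Fin n => u j.castSucc / u (Fin.last n)
  have hφd : ∀ i, φ₀ (d i) = u i / u (Fin.last n) :=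
    aeval_affinePoint (fun i => u i / u (Fin.last n)) (div_self hu0)
  have haff : affineQuadricPoly q = extendQF q P d := rfl
  have hφq : φ₀ (affineQuadricPoly q) = 0 := by
    have h1 : (fun i => φ₀ (d i)) = (u (Fin.last n))⁻¹ • u := by
      funext i
      rw [hφd, Pi.smul_apply, smul_eq_mul, div_eq_inv_mul]
    rw [haff, map_extendQF φ₀ q d, h1, QuadraticMap.map_smul, hext, hv, smul_zero]
  have hker : ∀ g, φ₀ g = 0 → g ∈ Ideal.span {affineQuadricPoly q} := by
    intro g hg
    obtain ⟨m, G, hG, hGu⟩ := exists_homogenization u hu0 g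
    have hH : aeval v (aeval ℓ G) = 0 := by
      have : ((aeval v).comp (aeval ℓ) : MvPolynomial (Fin (n + 1)) k →ₐ[k] K) = aeval u := by
        ext i
        simp only [AlgHom.comp_apply, aeval_X, hℓ]
      rw [← AlgHom.comp_apply, this, hGu]
      exact mul_eq_zero_of_right _ hg
    let δ : MvPolynomial (Fin (n + 1)) k →ₐ[k] P := aeval ((M.map (algebraMap k P)).mulVec d)
    have hNMd : (N.map (algebraMap k P)).mulVec ((M.map (algebraMap k P)).mulVec d) = d := by
      rw [Matrix.mulVec_mulVec, ← Matrix.map_mul, hNM, Matrix.map_one _ (map_zero _) (map_one _),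
        Matrix.one_mulVec]
    have hδ : δ (aeval ℓ G) = g := by
      have : (δ.comp (aeval ℓ) : MvPolynomial (Fin (n + 1)) k →ₐ[k] P) = aeval d := by
        ext1 i
        rw [AlgHom.comp_apply, aeval_X, aeval_X]
        conv_rhs => rw [← hNMd]
        simp [ℓ, δ, Matrix.mulVec, dotProduct]
      rw [← AlgHom.comp_apply, this]
      exact hG
    rw [Ideal.mem_span_singleton, haff]
    have h1 := map_dvd δ (hgen _ hH)
    rw [hδ, hquad, hNMd] at h1
    exact h1
  refine ⟨Ideal.Quotient.liftₐ (Ideal.span {affineQuadricPoly q}) φ₀ ?_, ?_⟩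
  · intro a ha
    obtain ⟨b, rfl⟩ := Ideal.mem_span_singleton.1 ha
    rw [map_mul, hφq, zero_mul]
  · rw [injective_iff_map_eq_zero]
    intro x hx
    obtain ⟨g, rfl⟩ := Ideal.Quotient.mk_surjective x
    exact Ideal.Quotient.eq_zero_iff_mem.2 (hker g hx)

end Embedding

section GenericZero

open Polynomial

theorem exists_generic_zero_of_tower {k F₁ F₂ F₃ : Type u} [Field k] [Field F₁] [Field F₂]
    [Field F₃] (h2 : (2 : k) ≠ 0)
    [Algebra k F₁] [Algebra k[X] F₁] [IsScalarTower k k[X] F₁] [IsFractionRing k[X] F₁]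
    [Algebra F₁ F₂] [Algebra F₁[X] F₂] [IsScalarTower F₁ F₁[X] F₂] [IsFractionRing F₁[X] F₂]
    [Algebra F₂ F₃] [Algebra F₂[X] F₃] [IsScalarTower F₂ F₂[X] F₃] [IsFractionRing F₂[X] F₃]
    [Algebra k F₂] [IsScalarTower k F₁ F₂] [Algebra k F₃] [IsScalarTower k F₂ F₃]
    [Algebra F₁ F₃] [IsScalarTower F₁ F₂ F₃] [IsScalarTower k F₁ F₃]
    {w : Fin 4 → k} (hw : ∀ i, w i ≠ 0) :
    ∃ (K : Type u) (_ : Field K) (_ : Algebra k K) (v : Fin 4 → K),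
      ∑ i, algebraMap k K (w i) * v i ^ 2 = 0 ∧
      (∀ H : MvPolynomial (Fin 4) k, MvPolynomial.aeval v H = 0 →
        (∑ i, MvPolynomial.C (w i) * MvPolynomial.X i ^ 2) ∣ H) ∧
      ∀ (D : Type u) [Ring D] [IsDomain D] [Algebra k D] [FiniteDimensional k D] (n : ℕ)
        (_ : Module.finrank k D = n ^ 2) (_ : D →ₐ[k] Module.End K (Fin n → K)),
        n = 1 ∨ n = 2 ∧
          HasAnticommuting k D ![0, -(w 3 / w 0), -(w 2 / w 0), -(w 1 / w 0)] := by
  set a := -(w 1 / w 0) with ha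
  set b := -(w 2 / w 0) with hb
  set c := -(w 3 / w 0) with hc
  have ha0 : a ≠ 0 := neg_ne_zero.2 (div_ne_zero (hw 1) (hw 0))
  have hb0 : b ≠ 0 := neg_ne_zero.2 (div_ne_zero (hw 2) (hw 0))
  have hc0 : c ≠ 0 := neg_ne_zero.2 (div_ne_zero (hw 3) (hw 0))
  let g₁ : Fin 1 → F₁ := Fin.cons (algebraMap k[X] F₁ X) fun i => algebraMap k F₁ (Fin.elim0 i)
  let g₂ : Fin 2 → F₂ := Fin.cons (algebraMap F₁[X] F₂ X) fun i => algebraMap F₁ F₂ (g₁ i)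
  let g : Fin 3 → F₃ := Fin.cons (algebraMap F₂[X] F₃ X) fun i => algebraMap F₂ F₃ (g₂ i)
  have hg₀ : AlgebraicIndependent k (fun i : Fin 0 => (Fin.elim0 i : k)) :=
    algebraicIndependent_empty_type
  have hg : AlgebraicIndependent k g := hg₀.cons_X.cons_X.cons_X
  let P : MvPolynomial (Fin 3) k := ∑ i, MvPolynomial.C (![a, b, c] i) * MvPolynomial.X i ^ 2
  set p₁ : F₁ := algebraMap k[X] F₁ (C c * X ^ 2 + C 0) with hp₁
  set p₂ : F₂ := algebraMap F₁[X] F₂ (C (algebraMap k F₁ b) * X ^ 2 + C p₁) with hp₂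
  set p : F₃ := algebraMap F₂[X] F₃ (C (algebraMap F₁ F₂ (algebraMap k F₁ a)) * X ^ 2 + C p₂)
    with hp
  have hPp : MvPolynomial.aeval g P = p := by
    have e₁ : ∀ x : F₁, algebraMap F₁[X] F₂ (C x) = algebraMap F₁ F₂ x := fun x =>
      (IsScalarTower.algebraMap_apply F₁ F₁[X] F₂ x).symm
    have e₂ : ∀ x : F₂, algebraMap F₂[X] F₃ (C x) = algebraMap F₂ F₃ x := fun x =>
      (IsScalarTower.algebraMap_apply F₂ F₂[X] F₃ x).symm
    have e₀ : ∀ x : k, algebraMap k[X] F₁ (C x) = algebraMap k F₁ x := fun x =>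
      (IsScalarTower.algebraMap_apply k k[X] F₁ x).symm
    have t₂ : ∀ x : k, algebraMap k F₃ x =
        algebraMap F₂ F₃ (algebraMap F₁ F₂ (algebraMap k F₁ x)) :=
      fun x => by
        rw [IsScalarTower.algebraMap_apply k F₂ F₃, IsScalarTower.algebraMap_apply k F₁ F₂]
    have g0 : g 0 = algebraMap F₂[X] F₃ X := rfl
    have g1 : g 1 = algebraMap F₂ F₃ (algebraMap F₁[X] F₂ X) := rfl
    have g2 : g 2 = algebraMap F₂ F₃ (algebraMap F₁ F₂ (algebraMap k[X] F₁ X)) := rfl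
    simp only [P, Fin.sum_univ_three, map_add, map_mul, map_pow, MvPolynomial.aeval_C,
      MvPolynomial.aeval_X, hp, hp₂, hp₁, e₀, e₁, e₂, t₂, g0, g1, g2, map_zero, add_zero]
    simp [add_assoc]
  have h2' : (2 : F₂) ≠ 0 := by
    simpa only [map_ofNat] using (map_ne_zero (algebraMap k F₂)).2 h2
  have hp₁0 : p₁ ≠ 0 := by
    rw [hp₁, Ne, map_eq_zero_iff _ (IsFractionRing.injective k[X] F₁)]
    intro h
    have := congrArg (coeff · 2) h
    simp at this
    exact hc0 this
  have hp₂0 : p₂ ≠ 0 := by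
    rw [hp₂, Ne, map_eq_zero_iff _ (IsFractionRing.injective F₁[X] F₂)]
    intro h
    have := congrArg (coeff · 0) h
    simp at this
    exact hp₁0 this
  have hsq : ¬IsSquare p := not_isSquare_quadratic h2' (by simpa using ha0) hp₂0
  have hirr : Irreducible (X ^ 2 - C p : F₃[X]) := by
    rw [X_pow_sub_C_irreducible_iff_of_prime Nat.prime_two]
    intro y hy
    exact hsq ⟨y, by rw [← hy, sq]⟩
  have : Fact (Irreducible (X ^ 2 - C p : F₃[X])) := ⟨hirr⟩
  let K := AdjoinRoot (X ^ 2 - C p : F₃[X])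
  let ω : K := AdjoinRoot.root _
  have hω : ω * ω = algebraMap F₃ K p := by
    have h := AdjoinRoot.eval₂_root (X ^ 2 - C p : F₃[X])
    rw [eval₂_sub, eval₂_X_pow, eval₂_C, sub_eq_zero] at h
    exact (sq ω).symm.trans h
  have hK : Module.finrank F₃ K = 2 := by
    rw [(AdjoinRoot.powerBasis hirr.ne_zero).finrank, AdjoinRoot.powerBasis_dim,
      natDegree_X_pow_sub_C]
  let v : Fin 4 → K := Fin.cons ω fun i => algebraMap F₃ K (g i)
  have hS : (∑ i, MvPolynomial.C (w i) * MvPolynomial.X i ^ 2 : MvPolynomial (Fin 4) k) =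
      MvPolynomial.C (w 0) * (MvPolynomial.X 0 ^ 2 - MvPolynomial.rename Fin.succ P) := by
    have e : ∀ x : k, (MvPolynomial.C x : MvPolynomial (Fin 4) k) =
        -(MvPolynomial.C (w 0) * MvPolynomial.C (-(x / w 0))) := fun x => by
      rw [← map_mul, ← map_neg]
      congr 1
      field_simp [hw 0]
    rw [Fin.sum_univ_four, e (w 1), e (w 2), e (w 3)]
    simp only [P, Fin.sum_univ_three, map_add, map_mul, map_pow, MvPolynomial.rename_C,
      MvPolynomial.rename_X, ← ha, ← hb, ← hc]
    simp
    ring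
  refine ⟨K, inferInstance, inferInstance, v, ?_, ?_, ?_⟩
  · have h : MvPolynomial.aeval v
        (∑ i, MvPolynomial.C (w i) * MvPolynomial.X i ^ 2 : MvPolynomial (Fin 4) k) = 0 := by
      have hv : MvPolynomial.aeval v (MvPolynomial.rename Fin.succ P) =
          algebraMap F₃ K (MvPolynomial.aeval g P) := by
        rw [MvPolynomial.aeval_rename]
        exact MvPolynomial.aeval_algebraMap_apply K g P
      rw [hS, map_mul, map_sub, map_pow, hv, hPp, MvPolynomial.aeval_X, ← hω]
      simp [v, pow_two ω]
    simpa using h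
  · intro H hH
    rw [hS]
    refine ((IsUnit.mk0 _ (hw 0)).map MvPolynomial.C).mul_left_dvd.2 ?_
    exact dvd_of_aeval_cons_eq_zero hg P (by rwa [hPp]) (by rw [hPp]; exact hω) H hH
  · intro D _ _ _ _ n hn ρ
    exact index_of_tower (F₁ := F₁) (F₂ := F₂) (F₃ := F₃) (K := K) hK a b c hω hn ρ

theorem exists_generic_zero {k : Type u} [Field k] (h2 : (2 : k) ≠ 0) {w : Fin 4 → k}
    (hw : ∀ i, w i ≠ 0) :
    ∃ (K : Type u) (_ : Field K) (_ : Algebra k K) (v : Fin 4 → K),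
      ∑ i, algebraMap k K (w i) * v i ^ 2 = 0 ∧
      (∀ H : MvPolynomial (Fin 4) k, MvPolynomial.aeval v H = 0 →
        (∑ i, MvPolynomial.C (w i) * MvPolynomial.X i ^ 2) ∣ H) ∧
      ∀ (D : Type u) [Ring D] [IsDomain D] [Algebra k D] [FiniteDimensional k D] (n : ℕ)
        (_ : Module.finrank k D = n ^ 2) (_ : D →ₐ[k] Module.End K (Fin n → K)),
        n = 1 ∨ n = 2 ∧
          HasAnticommuting k D ![0, -(w 3 / w 0), -(w 2 / w 0), -(w 1 / w 0)] :=
  exists_generic_zero_of_tower (F₁ := FractionRing k[X])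
    (F₂ := FractionRing (FractionRing k[X])[X])
    (F₃ := FractionRing (FractionRing (FractionRing k[X])[X])[X]) h2 hw

end GenericZero

section Splitting

theorem Algebra.IsCentral.of_matrix {k D : Type*} [Field k] [Ring D] [Algebra k D] {r : ℕ}
    [NeZero r] [Algebra.IsCentral k (Matrix (Fin r) (Fin r) D)] : Algebra.IsCentral k D where
  out x hx := by
    have hmem : Matrix.scalarAlgHom (Fin r) k x ∈
        Subalgebra.center k (Matrix (Fin r) (Fin r) D) := by
      rw [Matrix.subalgebraCenter_eq_scalarAlgHom_map]
      exact ⟨x, hx, rfl⟩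
    obtain ⟨c, hc⟩ := Algebra.mem_bot.1 (Algebra.IsCentral.out hmem)
    refine Algebra.mem_bot.2 ⟨c, ?_⟩
    have := congrFun (congrFun hc 0) 0
    simpa [Matrix.algebraMap_matrix_apply] using this

/-- A splitting over `L` yields a representation over any field receiving `L`. -/
theorem SplitsIn.exists_representation {k A L K : Type*} [Field k] [Ring A] [Algebra k A]
    [FiniteDimensional k A] [CommRing L] [Algebra k L] [Field K] [Algebra k K]
    (h : SplitsIn k A L) (f : L →ₐ[k] K) :
    ∃ (n : ℕ) (_ : A →ₐ[k] Module.End K (Fin n → K)), Module.finrank k A = n ^ 2 := by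
  obtain ⟨n, -, ⟨e⟩⟩ := h
  have : Nontrivial L := f.toRingHom.domain_nontrivial
  let ι : Matrix (Fin n) (Fin n) K →ₐ[k] Module.End K (Fin n → K) :=
    ((Matrix.toLinAlgEquiv' : Matrix (Fin n) (Fin n) K ≃ₐ[K] _).restrictScalars k).toAlgHom
  refine ⟨n, ((ι.comp f.mapMatrix).comp (e.restrictScalars k).toAlgHom).comp
    Algebra.TensorProduct.includeRight, ?_⟩
  rw [← Module.finrank_baseChange (R := L), e.toLinearEquiv.finrank_eq, Module.finrank_matrix]
  simp [sq]

theorem HasAnticommuting.comp {L E : Type*} [Field L] [Ring E] [Algebra L E] {ι κ : Type*}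
    {a : ι → L} (h : HasAnticommuting L E a) {f : κ → ι} (hf : Function.Injective f) :
    HasAnticommuting L E (a ∘ f) := by
  obtain ⟨θ, h1, h2⟩ := h
  exact ⟨θ ∘ f, fun i => h1 _, fun i j hij => h2 _ _ (hf.ne hij)⟩

end Splitting

theorem stmt_10 (k : Type u) [Field k] (h2 : (2 : k) ≠ 0)
    (q : QuadraticForm k (Fin 4 → k)) (hq : NondegQF q)
    (hns : ¬IsSquare (discQF q)) :
    ∀ (A : Type u) [Ring A] [Algebra k A] [Algebra.IsCentral k A] [IsSimpleRing A]
      [FiniteDimensional k A],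
      SplitsIn k A (quadricFunctionField q) → IsSplitAlg k A := by
  intro A _ _ _ _ _ hA
  obtain ⟨N, M, w, hNM, hw, hdisc, hext⟩ := exists_diagonalization h2 q hq
  obtain ⟨K, _, _, v, hv, hgen, hindex⟩ := exists_generic_zero h2 hw
  obtain ⟨φ, hφ⟩ := exists_injective_of_generic_zero (n := 3) q hNM (hw 0) hext hv hgen
  have : Nontrivial (quadricCoordRing q) := φ.toRingHom.domain_nontrivial
  let f : quadricFunctionField q →ₐ[k] K :=
    IsLocalization.liftAlgHom (M := nonZeroDivisors (quadricCoordRing q)) (f := φ) fun y =>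
      IsUnit.mk0 _ ((map_ne_zero_iff φ hφ).2 (nonZeroDivisors.ne_zero y.2))
  obtain ⟨n, ψ, hn⟩ := hA.exists_representation f
  have : IsArtinianRing A := IsArtinianRing.of_finite k A
  obtain ⟨r, hr, D, _, _, _, ⟨e⟩⟩ := IsSimpleRing.exists_algEquiv_matrix_divisionRing_finite k A
  have : Algebra.IsCentral k (Matrix (Fin r) (Fin r) D) := Algebra.IsCentral.of_algEquiv k _ _ e
  have : Algebra.IsCentral k D := Algebra.IsCentral.of_matrix (r := r)
  obtain ⟨m, ρ, rfl⟩ := exists_representation_of_matrix (ψ.comp e.symm.toAlgHom)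
  have hD : Module.finrank k D = m ^ 2 := by
    rw [e.toLinearEquiv.finrank_eq, Module.finrank_matrix] at hn
    simp only [Fintype.card_fin] at hn
    have hr0 : 0 < r * r := Nat.mul_pos (NeZero.pos r) (NeZero.pos r)
    apply Nat.eq_of_mul_eq_mul_left hr0
    rw [hn]
    ring
  rcases hindex D m hD ρ with rfl | ⟨rfl, h⟩
  · have hbij := Algebra.finrank_eq_one_iff_bijective_algebraMap.1 (hD.trans (one_pow 2))
    exact ⟨r, NeZero.pos r,
      ⟨e.trans (AlgEquiv.ofBijective (Algebra.ofId k D) hbij).symm.mapMatrix⟩⟩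
  · refine absurd ?_ hns
    have h3 : HasAnticommuting k D ![-(w 3 / w 0), -(w 2 / w 0), -(w 1 / w 0)] := by
      convert h.comp (Fin.succ_injective 3) using 1
      funext i
      fin_cases i <;> rfl
    obtain ⟨s, hs⟩ := isSquare_of_hasAnticommuting h2 hD
      (neg_ne_zero.2 (div_ne_zero (hw 1) (hw 0))) (neg_ne_zero.2 (div_ne_zero (hw 2) (hw 0))) h3
    have hdet : N.det ≠ 0 := by
      intro h0
      have := congrArg Matrix.det hNM
      rw [Matrix.det_mul, h0, zero_mul, Matrix.det_one] at this
      exact zero_ne_one this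
    have hprod : ∏ i, w i = (w 0 ^ 2 * s) ^ 2 := by
      have hw0 := hw 0
      have hs' : w 1 * w 2 * w 3 = s * s * w 0 ^ 3 := by
        rw [← hs]
        field_simp
      rw [Fin.prod_univ_four]
      linear_combination w 0 * hs'
    refine ⟨2 ^ 2 * (w 0 ^ 2 * s) / N.det, ?_⟩
    rw [hprod] at hdisc
    field_simp
    linear_combination hdisc

end
end

section
/- Let k be a field of characteristic ≠ 2, let a, b ∈ k×, and let N_{a,b} = ⟨1, −a, −b, ab⟩ be the norm form of the quaternion algebra ℍ(a,b). If N_{a,b} is anisotropic (equivalently, ℍ(a,b) is a division algebra), then the Brauer kernel of the quadric surface function field satisfies κ(k(N_{a,b})/k) = {0, [ℍ(a,b)]}, a subgroup of Br(k) of order 2. -/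
open scoped TensorProduct
open Quaternion
set_option synthInstance.maxHeartbeats 1000000
set_option maxHeartbeats 1000000
noncomputable section

universe u v

theorem Polynomial.exists_generator_of_rightIdeal {Δ : Type*} [DivisionRing Δ]
    (P : Polynomial Δ → Prop) (hsub : ∀ x y, P x → P y → P (x - y))
    (hmul : ∀ x y, P x → P (x * y)) {g : Polynomial Δ} (hg : g ≠ 0) (hPg : P g) :
    ∃ m, m ≠ 0 ∧ P m ∧ ∀ y, P y → ∃ c, y = m * c := by
  classical
  have hex : ∃ n : ℕ, ∃ x, x ≠ 0 ∧ P x ∧ x.natDegree = n := ⟨_, g, hg, hPg, rfl⟩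
  obtain ⟨x, hx, hPx, hxn⟩ := Nat.find_spec hex
  have hmonic := Polynomial.monic_mul_leadingCoeff_inv hx
  have hdeg : (x * Polynomial.C x.leadingCoeff⁻¹).natDegree = x.natDegree :=
    Polynomial.natDegree_mul_leadingCoeff_inv x hx
  set m := x * Polynomial.C x.leadingCoeff⁻¹ with hm
  have hPm : P m := hmul _ _ hPx
  refine ⟨m, hmonic.ne_zero, hPm, fun y hy => ⟨y /ₘ m, ?_⟩⟩
  have hdiv := Polynomial.modByMonic_add_div y m
  have hr : y %ₘ m = 0 := by
    by_contra hr
    have hPr : P (y %ₘ m) := by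
      have := hsub _ _ hy (hmul m (y /ₘ m) hPm)
      rwa [← eq_sub_of_add_eq hdiv] at this
    have hlt : (y %ₘ m).natDegree < m.natDegree :=
      Polynomial.natDegree_lt_natDegree hr (Polynomial.degree_modByMonic_lt y hmonic)
    have := Nat.find_min' hex ⟨_, hr, hPr, rfl⟩
    omega
  rw [hr, zero_add] at hdiv
  exact hdiv.symm

theorem Polynomial.exists_integral_anticommuting {Δ Q : Type*} [DivisionRing Δ] [Ring Q]
    (ι : Polynomial Δ →+* Q) (hι : Function.Injective ι) {u v : Q} {α β : Polynomial Δ}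
    (hα : ∀ m, α * m = m * α) (hβ : ∀ m, β * m = m * β)
    (hu : u * u = ι α) (hv : v * v = ι β) (huv : u * v = -(v * u))
    {g : Polynomial Δ} (hg : g ≠ 0) (hgu : u * ι g ∈ ι.range) (hgv : v * ι g ∈ ι.range)
    (hguv : u * v * ι g ∈ ι.range) :
    ∃ u' v' : Polynomial Δ, u' * u' = α ∧ v' * v' = β ∧ u' * v' = -(v' * u') := by
  obtain ⟨m, hm0, ⟨hmu, hmv, hmuv⟩, hgen⟩ := Polynomial.exists_generator_of_rightIdeal
    (fun x => u * ι x ∈ ι.range ∧ v * ι x ∈ ι.range ∧ u * v * ι x ∈ ι.range)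
    (fun x y hx hy => by
      simp only [map_sub, mul_sub]
      exact ⟨sub_mem hx.1 hy.1, sub_mem hx.2.1 hy.2.1, sub_mem hx.2.2 hy.2.2⟩)
    (fun x y hx => by
      simp only [map_mul, ← mul_assoc]
      have hy : ι y ∈ ι.range := ⟨y, rfl⟩
      exact ⟨mul_mem hx.1 hy, mul_mem hx.2.1 hy, mul_mem hx.2.2 hy⟩) hg ⟨hgu, hgv, hguv⟩
  have hr : ∀ x, ι x ∈ ι.range := fun x => ⟨x, rfl⟩
  have hvu : v * u = -(u * v) := by rw [huv, neg_neg]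
  obtain ⟨y, hy⟩ := hmu
  obtain ⟨z, hz⟩ := hmv
  obtain ⟨u', rfl⟩ := hgen y (by
    rw [hy]
    refine ⟨?_, ?_, ?_⟩
    · rw [← mul_assoc, hu]; exact mul_mem (hr _) (hr _)
    · rw [← mul_assoc, hvu, neg_mul]; exact neg_mem hmuv
    · rw [huv, ← mul_assoc, neg_mul, mul_assoc v, hu, neg_mul, mul_assoc, ← map_mul, hα, map_mul,
        ← mul_assoc, ← hz]
      exact neg_mem (mul_mem (hr _) (hr _)))
  obtain ⟨v', rfl⟩ := hgen z (by
    rw [hz]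
    refine ⟨?_, ?_, ?_⟩
    · rw [← mul_assoc]; exact hmuv
    · rw [← mul_assoc, hv]; exact mul_mem (hr _) (hr _)
    · rw [← mul_assoc, mul_assoc u, hv, mul_assoc, ← map_mul, hβ, map_mul, ← mul_assoc, ← hy]
      exact mul_mem (hr _) (hr _))
  refine ⟨u', v', ?_, ?_, ?_⟩ <;> apply mul_left_cancel₀ hm0 <;> apply hι
  · rw [← mul_assoc, map_mul, hy, mul_assoc, ← map_mul, hy, ← mul_assoc, hu, ← map_mul, hα]
  · rw [← mul_assoc, map_mul, hz, mul_assoc, ← map_mul, hz, ← mul_assoc, hv, ← map_mul, hβ]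
  · rw [mul_neg, map_neg, ← mul_assoc, ← mul_assoc, map_mul, map_mul _ (m * v'), hy, hz,
      mul_assoc, ← map_mul, hz, mul_assoc, ← map_mul, hy, ← mul_assoc, ← mul_assoc, huv, neg_mul]

section BaseChange

variable {K : Type*} [Field K] {L : Type*} [Field L] [Algebra K L] [Algebra (Polynomial K) L]
  [IsScalarTower K (Polynomial K) L] {Δ : Type*} [Ring Δ] [Algebra K Δ]

variable (K L Δ) in
/-- The inclusion `Δ[X] → L ⊗ Δ` for a `K`-algebra `Δ` and an extension `L` of `K[X]`. -/
noncomputable def polyToBaseChange : Polynomial Δ →ₐ[K] L ⊗[K] Δ :=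
  ((Algebra.TensorProduct.map (IsScalarTower.toAlgHom K (Polynomial K) L) (AlgHom.id K Δ)).comp
    (Algebra.TensorProduct.comm K Δ (Polynomial K)).toAlgHom).comp
    (polyEquivTensor K Δ).toAlgHom

theorem polyToBaseChange_smul (p : Polynomial K) (d : Δ) :
    polyToBaseChange K L Δ (d • p.map (algebraMap K Δ)) =
      algebraMap (Polynomial K) L p ⊗ₜ d := by
  rw [← polyEquivTensor_symm_apply_tmul_eq_smul]
  simp only [polyToBaseChange, AlgHom.comp_apply, AlgEquiv.toAlgHom_apply,
    AlgEquiv.apply_symm_apply, Algebra.TensorProduct.comm_tmul, Algebra.TensorProduct.map_tmul]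
  rfl

theorem polyToBaseChange_map (p : Polynomial K) :
    polyToBaseChange K L Δ (p.map (algebraMap K Δ)) = algebraMap (Polynomial K) L p ⊗ₜ 1 := by
  rw [← polyToBaseChange_smul, one_smul]

theorem polyToBaseChange_map_mul_comm (p : Polynomial K) (q : L ⊗[K] Δ) :
    polyToBaseChange K L Δ (p.map (algebraMap K Δ)) * q =
      q * polyToBaseChange K L Δ (p.map (algebraMap K Δ)) := by
  rw [polyToBaseChange_map]
  exact Algebra.commutes (algebraMap (Polynomial K) L p) q

theorem Polynomial.map_algebraMap_mul_comm (p : Polynomial K) (q : Polynomial Δ) :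
    p.map (algebraMap K Δ) * q = q * p.map (algebraMap K Δ) :=
  letI := Polynomial.algebra K Δ
  Algebra.commutes p q

variable [IsFractionRing (Polynomial K) L]

theorem polyToBaseChange_injective : Function.Injective (polyToBaseChange K L Δ) := by
  have h : Function.Injective (Algebra.TensorProduct.map
      (IsScalarTower.toAlgHom K (Polynomial K) L) (AlgHom.id K Δ)) :=
    Module.Flat.rTensor_preserves_injective_linearMap (M := Δ)
      (IsScalarTower.toAlgHom K (Polynomial K) L).toLinearMap
      (IsFractionRing.injective (Polynomial K) L)
  simp only [polyToBaseChange, AlgHom.coe_comp]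
  exact (h.comp (AlgEquiv.injective _)).comp (AlgEquiv.injective _)

theorem exists_mul_mem_range_polyToBaseChange (q : L ⊗[K] Δ) :
    ∃ g : Polynomial K, g ≠ 0 ∧
      q * polyToBaseChange K L Δ (g.map (algebraMap K Δ)) ∈ (polyToBaseChange K L Δ).range := by
  induction q with
  | zero => exact ⟨1, one_ne_zero, by rw [zero_mul]; exact zero_mem _⟩
  | tmul l d =>
    obtain ⟨p, g, hg, rfl⟩ := IsFractionRing.div_surjective (A := Polynomial K) l
    have hg0 := nonZeroDivisors.ne_zero hg
    refine ⟨g, hg0, d • p.map (algebraMap K Δ), ?_⟩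
    have : algebraMap (Polynomial K) L g ≠ 0 := by simpa using hg0
    simp only [AlgHom.toRingHom_eq_coe, RingHom.coe_coe]
    rw [polyToBaseChange_smul, polyToBaseChange_map, Algebra.TensorProduct.tmul_mul_tmul, mul_one,
      div_mul_cancel₀ _ this]
  | add x y hx hy =>
    obtain ⟨g, hg, hgx⟩ := hx
    obtain ⟨h, hh, hhy⟩ := hy
    refine ⟨g * h, mul_ne_zero hg hh, ?_⟩
    have hr : ∀ z, polyToBaseChange K L Δ z ∈ (polyToBaseChange K L Δ).range := fun z => ⟨z, rfl⟩
    rw [add_mul]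
    refine add_mem ?_ ?_
    · rw [Polynomial.map_mul, map_mul, ← mul_assoc]
      exact mul_mem hgx (hr _)
    · rw [mul_comm, Polynomial.map_mul, map_mul, ← mul_assoc]
      exact mul_mem hhy (hr _)

theorem isDomain_baseChange [IsDomain Δ] : IsDomain (L ⊗[K] Δ) := by
  have hinj := polyToBaseChange_injective (K := K) (L := L) (Δ := Δ)
  have hfac : ∀ g : Polynomial K, g ≠ 0 → IsUnit (polyToBaseChange K L Δ
      (g.map (algebraMap K Δ))) := fun g hg => by
    rw [polyToBaseChange_map]
    have : IsUnit (algebraMap (Polynomial K) L g) := by simpa using hg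
    exact this.map (algebraMap L (L ⊗[K] Δ))
  have : Nontrivial (L ⊗[K] Δ) := hinj.nontrivial
  have : NoZeroDivisors (L ⊗[K] Δ) := ⟨fun {x y} hxy => by
    obtain ⟨g, hg, p, hp⟩ := exists_mul_mem_range_polyToBaseChange x
    obtain ⟨h, hh, r, hr⟩ := exists_mul_mem_range_polyToBaseChange y
    have hpr : p * r = 0 := by
      apply hinj
      change polyToBaseChange K L Δ p = _ at hp
      change polyToBaseChange K L Δ r = _ at hr
      rw [map_mul, hp, hr, mul_assoc, ← mul_assoc _ y, polyToBaseChange_map_mul_comm g y,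
        mul_assoc, ← mul_assoc, hxy, zero_mul, map_zero]
    rcases mul_eq_zero.mp hpr with rfl | rfl
    · left
      rw [map_zero] at hp
      exact (hfac g hg).mul_left_eq_zero.mp hp.symm
    · right
      rw [map_zero] at hr
      exact (hfac h hh).mul_left_eq_zero.mp hr.symm⟩
  exact NoZeroDivisors.to_isDomain _

theorem exists_polynomial_anticommuting [IsDomain Δ] [FiniteDimensional K Δ] {u v : L ⊗[K] Δ}
    {α β : Polynomial K} (hu : u * u = algebraMap (Polynomial K) L α ⊗ₜ 1)
    (hv : v * v = algebraMap (Polynomial K) L β ⊗ₜ 1) (huv : u * v = -(v * u)) :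
    ∃ u' v' : Polynomial Δ, u' * u' = α.map (algebraMap K Δ) ∧ v' * v' = β.map (algebraMap K Δ) ∧
      u' * v' = -(v' * u') := by
  let _ := divisionRingOfFiniteDimensional K Δ
  obtain ⟨g₁, hg₁, h₁⟩ := exists_mul_mem_range_polyToBaseChange u
  obtain ⟨g₂, hg₂, h₂⟩ := exists_mul_mem_range_polyToBaseChange v
  obtain ⟨g₃, hg₃, h₃⟩ := exists_mul_mem_range_polyToBaseChange (u * v)
  have hr : ∀ z, polyToBaseChange K L Δ z ∈ (polyToBaseChange K L Δ).range := fun z => ⟨z, rfl⟩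
  rw [← polyToBaseChange_map] at hu hv
  have hg : (g₁ * g₂ * g₃).map (algebraMap K Δ) ≠ 0 :=
    (Polynomial.map_ne_zero_iff (algebraMap K Δ).injective).mpr (by simp [hg₁, hg₂, hg₃])
  refine Polynomial.exists_integral_anticommuting (polyToBaseChange K L Δ).toRingHom
    polyToBaseChange_injective (Polynomial.map_algebraMap_mul_comm α)
    (Polynomial.map_algebraMap_mul_comm β) hu hv huv hg ?_ ?_ ?_
  · rw [mul_assoc, Polynomial.map_mul, map_mul, ← mul_assoc]
    exact mul_mem h₁ (hr _)
  · rw [mul_comm g₁, mul_assoc, Polynomial.map_mul, map_mul, ← mul_assoc]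
    exact mul_mem h₂ (hr _)
  · rw [mul_comm, Polynomial.map_mul, map_mul, ← mul_assoc]
    exact mul_mem h₃ (hr _)

theorem Polynomial.mul_self_linear (u v : Δ) :
    (Polynomial.C u * Polynomial.X + Polynomial.C v) *
      (Polynomial.C u * Polynomial.X + Polynomial.C v) =
      Polynomial.C (u * u) * Polynomial.X ^ 2 + Polynomial.C (u * v + v * u) * Polynomial.X +
        Polynomial.C (v * v) := by
  simp only [mul_add, add_mul, map_mul, map_add, mul_assoc, pow_two, Polynomial.X_mul]
  abel

theorem Polynomial.natDegree_le_one_of_mul_self_eq [IsDomain Δ] {p : Polynomial Δ} {a c : K}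
    (hp : p * p = (Polynomial.C a * Polynomial.X ^ 2 + Polynomial.C c).map (algebraMap K Δ)) :
    p.natDegree ≤ 1 := by
  have h : (p ^ 2).natDegree ≤ 2 := by
    rw [pow_two, hp]
    refine Polynomial.natDegree_map_le.trans ?_
    compute_degree
  rw [Polynomial.natDegree_pow] at h
  omega

theorem exists_anticommuting_of_mul_self_eq [IsDomain Δ] [FiniteDimensional K Δ] {d : L ⊗[K] Δ}
    {a c : K} (hd : d * d =
      algebraMap (Polynomial K) L (Polynomial.C a * Polynomial.X ^ 2 + Polynomial.C c) ⊗ₜ 1) :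
    ∃ u v : Δ, u * u = algebraMap K Δ a ∧ v * v = algebraMap K Δ c ∧ u * v = -(v * u) := by
  obtain ⟨p, -, hp, -, -⟩ := exists_polynomial_anticommuting (v := 0) (β := 0) hd
    (by simp) (by simp)
  have hdeg := Polynomial.natDegree_le_one_of_mul_self_eq hp
  rw [Polynomial.eq_X_add_C_of_natDegree_le_one hdeg] at hp
  generalize p.coeff 1 = u at hp
  generalize p.coeff 0 = v at hp
  rw [Polynomial.mul_self_linear] at hp
  have h0 := congrArg (Polynomial.coeff · 0) hp
  have h1 := congrArg (Polynomial.coeff · 1) hp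
  have h2 := congrArg (Polynomial.coeff · 2) hp
  simp [Polynomial.coeff_X, Polynomial.coeff_C, -map_mul, -map_add, -Polynomial.map_mul] at h0 h1 h2
  exact ⟨u, v, h2, h0, eq_neg_of_add_eq_zero_left h1⟩

theorem exists_constant_anticommuting [IsDomain Δ] [FiniteDimensional K Δ] {u v : L ⊗[K] Δ}
    {a b c : K} (hu : u * u = algebraMap K (L ⊗[K] Δ) a)
    (hv : v * v =
      algebraMap (Polynomial K) L (Polynomial.C b * Polynomial.X ^ 2 + Polynomial.C c) ⊗ₜ 1)
    (huv : u * v = -(v * u)) :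
    ∃ i j : Δ, i * i = algebraMap K Δ a ∧ j * j = algebraMap K Δ b ∧ i * j = -(j * i) := by
  obtain ⟨p, q, hp, hq, hpq⟩ := exists_polynomial_anticommuting
    (α := Polynomial.C a) (by
      rw [hu, ← Polynomial.algebraMap_eq,
        ← IsScalarTower.algebraMap_apply]
      rfl) hv huv
  have hpdeg : p.natDegree = 0 := by
    have h : (p ^ 2).natDegree = 0 := by
      rw [pow_two, hp, Polynomial.map_C, Polynomial.natDegree_C]
    rw [Polynomial.natDegree_pow] at h
    omega
  have hqdeg := Polynomial.natDegree_le_one_of_mul_self_eq hq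
  rw [Polynomial.eq_C_of_natDegree_eq_zero hpdeg] at hp hpq
  rw [Polynomial.eq_X_add_C_of_natDegree_le_one hqdeg] at hq hpq
  generalize p.coeff 0 = i at hp hpq
  generalize q.coeff 1 = j at hq hpq
  generalize q.coeff 0 = z at hq hpq
  rw [Polynomial.mul_self_linear] at hq
  have h0 := congrArg (Polynomial.coeff · 0) hp
  have h1 := congrArg (Polynomial.coeff · 1) hpq
  have h2 := congrArg (Polynomial.coeff · 2) hq
  simp [Polynomial.coeff_C, mul_add, add_mul, ← mul_assoc,
    Polynomial.coeff_mul_C] at h0 h1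
  simp [-map_mul, -map_add, -Polynomial.map_mul] at h2
  exact ⟨i, j, h0, h2, h1⟩

end BaseChange

/-- Transitivity of base change for a not necessarily commutative algebra. -/
noncomputable def cancelBaseChangeAlgEquiv (k K F A : Type*) [CommRing k] [CommRing K]
    [CommRing F] [Algebra k K] [Algebra K F] [Algebra k F] [IsScalarTower k K F] [Ring A]
    [Algebra k A] : F ⊗[K] (K ⊗[k] A) ≃ₐ[F] F ⊗[k] A :=
  AlgEquiv.symm <| Algebra.TensorProduct.algEquivOfLinearEquivTensorProduct
    (TensorProduct.AlgebraTensorModule.cancelBaseChange k K F F A).symm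
    (by simp) (by simp [Algebra.TensorProduct.one_def])

theorem exists_quaternion_generators {k K E D : Type*} [Field k] [Field K] [Field E]
    [Algebra k K] [Algebra (Polynomial k) K] [IsScalarTower k (Polynomial k) K]
    [IsFractionRing (Polynomial k) K] [Algebra k E] [Algebra K E] [IsScalarTower k K E]
    [Algebra (Polynomial K) E] [IsScalarTower K (Polynomial K) E] [IsFractionRing (Polynomial K) E]
    [Ring D] [IsDomain D] [Algebra k D] [FiniteDimensional k D] {a b c : k} {d : E ⊗[k] D}
    (hd : d * d = algebraMap E (E ⊗[k] D) (algebraMap (Polynomial K) E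
      (Polynomial.C (algebraMap k K a) * Polynomial.X ^ 2 + Polynomial.C (algebraMap (Polynomial k) K
        (Polynomial.C b * Polynomial.X ^ 2 + Polynomial.C c))))) :
    ∃ i j : D, i * i = algebraMap k D a ∧ j * j = algebraMap k D b ∧ i * j = -(j * i) := by
  have := isDomain_baseChange (K := k) (L := K) (Δ := D)
  have hd' := congrArg (cancelBaseChangeAlgEquiv k K E D).symm hd
  rw [map_mul, AlgEquiv.commutes] at hd'
  obtain ⟨u, v, hu, hv, huv⟩ := exists_anticommuting_of_mul_self_eq (K := K) (L := E) hd'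
  refine exists_constant_anticommuting (K := k) (L := K) (u := u) (v := v) (c := c) ?_ hv huv
  rw [hu, ← IsScalarTower.algebraMap_apply]

theorem isDomain_baseChange_baseChange {k K E D : Type*} [Field k] [Field K] [Field E]
    [Algebra k K] [Algebra (Polynomial k) K] [IsScalarTower k (Polynomial k) K]
    [IsFractionRing (Polynomial k) K] [Algebra k E] [Algebra K E] [IsScalarTower k K E]
    [Algebra (Polynomial K) E] [IsScalarTower K (Polynomial K) E] [IsFractionRing (Polynomial K) E]
    [Ring D] [IsDomain D] [Algebra k D] : IsDomain (E ⊗[k] D) := by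
  have := isDomain_baseChange (K := k) (L := K) (Δ := D)
  have := isDomain_baseChange (K := K) (L := E) (Δ := K ⊗[k] D)
  exact (cancelBaseChangeAlgEquiv k K E D).symm.toMulEquiv.isDomain _

/-- If a quadratic extension `F = E(√f)` splits a division algebra `E ⊗ D`, then `E ⊗ D` is either
`E` itself or of degree two and contains a square root of `f`. -/
theorem degree_le_two_of_split_quadratic {k E F D : Type*} [Field k] [Field E] [Field F]
    [Algebra k E] [Algebra E F] [Algebra k F] [IsScalarTower k E F]
    [Ring D] [Algebra k D] [FiniteDimensional k D] [IsDomain (E ⊗[k] D)]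
    (hF : Module.finrank E F = 2) {θ : F} {f : E} (hθ : θ * θ = algebraMap E F f) {n : ℕ}
    (hn : 0 < n) (e : F ⊗[k] D ≃ₐ[F] Matrix (Fin n) (Fin n) F) :
    Module.finrank k D = 1 ∨
      Module.finrank k D = 4 ∧ ∃ d : E ⊗[k] D, d * d = algebraMap E (E ⊗[k] D) f := by
  have hfin : Module.Finite E F := Module.finite_of_finrank_pos (by omega)
  have hD : Module.finrank k D = n * n := by
    rw [← Module.finrank_baseChange (R := F), e.toLinearEquiv.finrank_eq, Module.finrank_matrix]
    simp
  let φ : E ⊗[k] D →ₐ[E] Matrix (Fin n) (Fin n) F :=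
    (e.toAlgHom.restrictScalars E).comp
      (Algebra.TensorProduct.map (Algebra.ofId E F) (AlgHom.id k D))
  let w : Fin n → F := Pi.single ⟨0, hn⟩ 1
  have hw : w ≠ 0 := by simp [w]
  let T : E ⊗[k] D →ₗ[E] (Fin n → F) :=
    { toFun := fun q => (φ q).mulVec w
      map_add' := fun x y => by rw [map_add, Matrix.add_mulVec]
      map_smul' := fun c x => by rw [map_smul, Matrix.smul_mulVec, RingHom.id_apply] }
  have hTmul : ∀ x y, T (x * y) = (φ x).mulVec (T y) := fun x y => by
    change (φ (x * y)).mulVec w = (φ x).mulVec ((φ y).mulVec w)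
    rw [map_mul, Matrix.mulVec_mulVec]
  have hT : Function.Injective T := by
    rw [injective_iff_map_eq_zero]
    intro q hq
    by_contra hq0
    obtain ⟨q', hq'⟩ := (FiniteDimensional.isUnit E hq0).exists_left_inv
    have h1 : T (q' * q) = w := by rw [hq']; simp [T]
    rw [hTmul, hq, Matrix.mulVec_zero] at h1
    exact hw h1.symm
  have hfE : Module.finrank E (E ⊗[k] D) = n * n := by rw [Module.finrank_baseChange, hD]
  have hfV : Module.finrank E (Fin n → F) = n * 2 := by simp [Module.finrank_pi_fintype, hF]
  have hle := LinearMap.finrank_le_finrank_of_injective hT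
  rw [hfE, hfV] at hle
  have hn2 : n ≤ 2 := Nat.le_of_mul_le_mul_left hle hn
  obtain rfl | rfl : n = 1 ∨ n = 2 := by omega
  · left; rw [hD]
  right
  refine ⟨hD, ?_⟩
  have hsurj : Function.Surjective T :=
    (LinearMap.injective_iff_surjective_of_finrank_eq_finrank (by rw [hfE, hfV])).mp hT
  obtain ⟨d, hd⟩ := hsurj (θ • w)
  refine ⟨d, hT ?_⟩
  rw [hTmul, hd, Matrix.mulVec_smul]
  change θ • T d = _
  rw [hd, smul_smul, hθ]
  change _ = (φ (algebraMap E _ f)).mulVec w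
  rw [AlgHom.commutes, algebraMap_smul, Algebra.algebraMap_eq_smul_one, Matrix.smul_mulVec,
    Matrix.one_mulVec]

/-- Base change commutes with forming matrix algebras. -/
noncomputable def baseChangeMatrixEquiv (k F A : Type*) [CommRing k] [CommRing F] [Algebra k F]
    [Ring A] [Algebra k A] (n : ℕ) :
    F ⊗[k] Matrix (Fin n) (Fin n) A ≃ₐ[F] Matrix (Fin n) (Fin n) (F ⊗[k] A) :=
  ((Algebra.TensorProduct.congr (Matrix.uniqueAlgEquiv (m := Unit) (R := F) (A := F)).symm
    AlgEquiv.refl).trans (Matrix.kroneckerTMulAlgEquiv Unit (Fin n) k F F A)).trans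
    (Matrix.reindexAlgEquiv F _ (Equiv.uniqueProd (Fin n) Unit))

/-- An algebra with a split matrix algebra is split. -/
theorem exists_algEquiv_matrix_of_matrix_algEquiv {F B : Type*} [Field F] [Ring B] [Algebra F B]
    {r N : ℕ} (hr : 0 < r) (hN : 0 < N)
    (φ : Matrix (Fin r) (Fin r) B ≃ₐ[F] Matrix (Fin N) (Fin N) F) :
    ∃ n : ℕ, 0 < n ∧ Nonempty (B ≃ₐ[F] Matrix (Fin n) (Fin n) F) := by
  let o : Fin r := ⟨0, hr⟩
  let ψ : Matrix (Fin r) (Fin r) B ≃ₐ[F] Module.End F (Fin N → F) := φ.trans Matrix.toLinAlgEquiv'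
  let s : B → Module.End F (Fin N → F) := fun b => ψ (Matrix.single o o b)
  have hs_mul : ∀ x y, s (x * y) = s x * s y := fun x y => by
    simp only [s]; rw [← map_mul, Matrix.single_mul_single_same]
  let W := LinearMap.range (s 1)
  have hsW : ∀ b x, s b x ∈ W := fun b x => ⟨s b x, by
    rw [← Module.End.mul_apply, ← hs_mul, one_mul]⟩
  have hW : ∀ w ∈ W, s 1 w = w := by
    rintro _ ⟨x, rfl⟩
    rw [← Module.End.mul_apply, ← hs_mul, one_mul]
  let ρ : B →ₐ[F] Module.End F W := AlgHom.ofLinearMap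
    { toFun := fun b => (s b).restrict (fun x _ => hsW b x)
      map_add' := fun x y => by
        ext w
        simp [s, Matrix.single_add]
      map_smul' := fun c x => by
        ext w
        simp [s, ← Matrix.smul_single] }
    (by ext w; simp [hW w w.2])
    (fun x y => by ext w; simp [hs_mul])
  have hinj : Function.Injective ρ := by
    rw [injective_iff_map_eq_zero]
    intro b hb
    have h0 : s b = 0 := by
      refine LinearMap.ext fun x => ?_
      have h1 : s b x = s b (s 1 x) := by rw [← Module.End.mul_apply, ← hs_mul, mul_one]
      rw [h1]
      have := congrArg Subtype.val (LinearMap.congr_fun hb ⟨s 1 x, hsW 1 x⟩)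
      exact this
    have h2 : Matrix.single o o b = 0 := ψ.injective (by rw [map_zero]; exact h0)
    have := congrFun (congrFun h2 o) o
    simpa using this
  have hsurj : Function.Surjective ρ := by
    intro g
    obtain ⟨M, hM⟩ := ψ.surjective (W.subtype ∘ₗ g ∘ₗ (s 1).rangeRestrict)
    refine ⟨M o o, ?_⟩
    have h1 : Matrix.single o o (M o o) = Matrix.single o o 1 * M * Matrix.single o o 1 := by
      rw [Matrix.single_mul_mul_single, one_mul, mul_one]
    have h2 : s (M o o) = s 1 * ψ M * s 1 := by
      simp only [s]; rw [h1, map_mul, map_mul]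
    refine LinearMap.ext fun w => Subtype.ext ?_
    change ((s (M o o)) w : Fin N → F) = g w
    rw [h2, hM]
    simp only [Module.End.mul_apply, hW w w.2]
    have h3 : (s 1).rangeRestrict (w : Fin N → F) = w := Subtype.ext (hW w w.2)
    simp only [LinearMap.comp_apply, h3]
    exact hW _ (g w).2
  have hB : Nontrivial B := by
    by_contra hB
    rw [not_nontrivial_iff_subsingleton] at hB
    have : Subsingleton (Matrix (Fin r) (Fin r) B) := inferInstance
    have h1 := φ.symm.injective.subsingleton
    have : NeZero N := ⟨hN.ne'⟩
    exact not_subsingleton (Matrix (Fin N) (Fin N) F) h1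
  let e := (AlgEquiv.ofBijective ρ ⟨hinj, hsurj⟩).trans (algEquivMatrix (Module.finBasis F W))
  refine ⟨Module.finrank F W, Nat.pos_of_ne_zero fun h => ?_, ⟨e⟩⟩
  have : IsEmpty (Fin (Module.finrank F W)) := by rw [h]; infer_instance
  exact not_subsingleton B e.injective.subsingleton

/-- Splitting passes to larger extensions. -/
theorem exists_algEquiv_matrix_baseChange {k K F A : Type*} [Field k] [CommRing K] [CommRing F]
    [Algebra k K] [Algebra K F] [Algebra k F] [IsScalarTower k K F] [Ring A] [Algebra k A] {n : ℕ}
    (e : K ⊗[k] A ≃ₐ[K] Matrix (Fin n) (Fin n) K) :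
    Nonempty (F ⊗[k] A ≃ₐ[F] Matrix (Fin n) (Fin n) F) := by
  let e₁ : F ⊗[k] A ≃ₐ[F] F ⊗[K] (K ⊗[k] A) :=
    (cancelBaseChangeAlgEquiv k K F A).symm
  let e₂ : F ⊗[K] (K ⊗[k] A) ≃ₐ[F] F ⊗[K] Matrix (Fin n) (Fin n) K :=
    Algebra.TensorProduct.congr AlgEquiv.refl e
  let e₃ : F ⊗[K] Matrix (Fin n) (Fin n) K ≃ₐ[F] Matrix (Fin n) (Fin n) (F ⊗[K] K) :=
    baseChangeMatrixEquiv K F K n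
  exact ⟨((e₁.trans e₂).trans e₃).trans (Algebra.TensorProduct.rid K F F).mapMatrix⟩

section Quaternion

variable {k : Type*} [Field k] {a b : k}

theorem quaternion_conj_mul_self (x : ℍ[k,a,b]) :
    (⟨x.re, -x.imI, -x.imJ, -x.imK⟩ : ℍ[k,a,b]) * x =
      algebraMap k ℍ[k,a,b]
        (QuadraticMap.weightedSumSquares k ![1, -a, -b, a * b] ![x.re, x.imI, x.imJ, x.imK]) := by
  simp only [QuadraticMap.weightedSumSquares_apply, Fin.sum_univ_four]
  ext <;> simp [QuaternionAlgebra.algebraMap_eq] <;> ring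

theorem quaternion_normForm_ne_zero
    (haniso : (QuadraticMap.weightedSumSquares k ![1, -a, -b, a * b]).Anisotropic)
    {x : ℍ[k,a,b]} (hx : x ≠ 0) :
    QuadraticMap.weightedSumSquares k ![1, -a, -b, a * b] ![x.re, x.imI, x.imJ, x.imK] ≠ 0 := by
  intro h
  have h0 := haniso _ h
  apply hx
  ext
  · exact congrFun h0 0
  · exact congrFun h0 1
  · exact congrFun h0 2
  · exact congrFun h0 3

theorem quaternion_isUnit
    (haniso : (QuadraticMap.weightedSumSquares k ![1, -a, -b, a * b]).Anisotropic)
    {x : ℍ[k,a,b]} (hx : x ≠ 0) : ∃ y : ℍ[k,a,b], y * x = 1 := by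
  have hN := quaternion_normForm_ne_zero haniso hx
  refine ⟨algebraMap k _ (QuadraticMap.weightedSumSquares k ![1, -a, -b, a * b]
    ![x.re, x.imI, x.imJ, x.imK])⁻¹ * ⟨x.re, -x.imI, -x.imJ, -x.imK⟩, ?_⟩
  rw [mul_assoc, quaternion_conj_mul_self, ← map_mul, inv_mul_cancel₀ hN, map_one]

theorem not_isSplit_quaternion
    (haniso : (QuadraticMap.weightedSumSquares k ![1, -a, -b, a * b]).Anisotropic) {n : ℕ}
    (e : ℍ[k,a,b] ≃ₐ[k] Matrix (Fin n) (Fin n) k) : False := by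
  have hdim := e.toLinearEquiv.finrank_eq
  rw [QuaternionAlgebra.finrank_eq_four, Module.finrank_matrix] at hdim
  simp only [Fintype.card_fin, Module.finrank_self, mul_one] at hdim
  obtain rfl : n = 2 := by nlinarith
  let M : Matrix (Fin 2) (Fin 2) k := Matrix.single 0 1 1
  have hM : M ≠ 0 := fun h => by simpa [M] using congrFun (congrFun h 0) 1
  have hMM : M * M = 0 := by simp [M]
  obtain ⟨y, hy⟩ := quaternion_isUnit haniso (x := e.symm M) (by simpa using hM)
  have h1 : e y * M = 1 := by
    have := congrArg e hy
    rwa [map_mul, map_one, AlgEquiv.apply_symm_apply] at this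
  apply hM
  rw [← one_mul M, ← h1, mul_assoc, hMM, mul_zero]

/-- The algebra homomorphism from a quaternion algebra given by two anticommuting elements. -/
def quaternionLift {D : Type*} [Ring D] [Algebra k D] (i j : D) (hi : i * i = algebraMap k D a)
    (hj : j * j = algebraMap k D b) (hij : i * j = -(j * i)) : ℍ[k,a,b] →ₐ[k] D :=
  QuaternionAlgebra.lift
    { i := i, j := j, k := i * j
      i_mul_i := by rw [hi, Algebra.algebraMap_eq_smul_one, zero_smul, add_zero]
      j_mul_j := by rw [hj, Algebra.algebraMap_eq_smul_one]
      i_mul_j := rfl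
      j_mul_i := by rw [hij, zero_smul, zero_sub, neg_neg] }

theorem nonempty_algEquiv_quaternion
    (haniso : (QuadraticMap.weightedSumSquares k ![1, -a, -b, a * b]).Anisotropic)
    {D : Type*} [Ring D] [Nontrivial D] [Algebra k D] [FiniteDimensional k D]
    (hD : Module.finrank k D = 4)
    {i j : D} (hi : i * i = algebraMap k D a) (hj : j * j = algebraMap k D b)
    (hij : i * j = -(j * i)) : Nonempty (D ≃ₐ[k] ℍ[k,a,b]) := by
  let φ := quaternionLift i j hi hj hij
  have hinj : Function.Injective φ := by
    rw [injective_iff_map_eq_zero]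
    intro x hx
    by_contra hx0
    obtain ⟨y, hy⟩ := quaternion_isUnit haniso hx0
    have := congrArg φ hy
    rw [map_mul, hx, mul_zero, map_one] at this
    exact zero_ne_one this
  have hsurj : Function.Surjective φ.toLinearMap :=
    (LinearMap.injective_iff_surjective_of_finrank_eq_finrank
      (by rw [QuaternionAlgebra.finrank_eq_four, hD])).mp hinj
  exact ⟨(AlgEquiv.ofBijective φ ⟨hinj, hsurj⟩).symm⟩

theorem exists_eq_sq_sub_mul_sq_of_quadric_point {F : Type*} [Field F] (h2 : (2 : F) ≠ 0)
    {a b x y z : F} (ha : a ≠ 0) (h : x ^ 2 - a * y ^ 2 - b * z ^ 2 + a * b = 0) :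
    ∃ p q : F, p ^ 2 - a * q ^ 2 = b := by
  by_cases hz : z ^ 2 = a
  · have hz0 : z ≠ 0 := by rintro rfl; exact ha (by rw [← hz]; ring)
    refine ⟨(b + 1) / 2, (b - 1) / (2 * z), ?_⟩
    rw [← hz]
    field_simp
    ring
  · have hz' : z ^ 2 - a ≠ 0 := sub_ne_zero.mpr hz
    refine ⟨(x * z + a * y) / (z ^ 2 - a), (x + y * z) / (z ^ 2 - a), ?_⟩
    field_simp
    linear_combination (z ^ 2 - a) * h

theorem nonempty_baseChange_quaternion_algEquiv {F : Type*} [Field F] [Algebra k F]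
    (h2 : (2 : F) ≠ 0) (ha : a ≠ 0) (hb : b ≠ 0) {p q : F}
    (h : p ^ 2 - algebraMap k F a * q ^ 2 = algebraMap k F b) :
    Nonempty (F ⊗[k] ℍ[k,a,b] ≃ₐ[F] Matrix (Fin 2) (Fin 2) F) := by
  have ha' : algebraMap k F a ≠ 0 := by simpa using ha
  have hb' : algebraMap k F b ≠ 0 := by simpa using hb
  generalize hc : algebraMap k F a = c at h ha'
  let I : Matrix (Fin 2) (Fin 2) F := !![0, c; 1, 0]
  let J : Matrix (Fin 2) (Fin 2) F := !![p, -(c * q); q, -p]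
  have hI : I * I = algebraMap k _ a := by
    ext i j
    fin_cases i <;> fin_cases j <;> simp [I, Matrix.algebraMap_matrix_apply, hc]
  have hJ : J * J = algebraMap k _ b := by
    ext i j
    fin_cases i <;> fin_cases j <;>
      simp [J, Matrix.algebraMap_matrix_apply, ← h] <;> ring
  have hIJ : I * J = -(J * I) := by
    ext i j
    fin_cases i <;> fin_cases j <;> simp [I, J] <;> ring
  let φ : F ⊗[k] ℍ[k,a,b] →ₐ[F] Matrix (Fin 2) (Fin 2) F :=
    Algebra.TensorProduct.lift (Algebra.ofId F _) (quaternionLift I J hI hJ hIJ)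
      (fun x y => Algebra.commutes x _)
  have hφ : ∀ (t : F) x, φ (t ⊗ₜ x) = t • quaternionLift I J hI hJ hIJ x := fun t x =>
    (Algebra.TensorProduct.lift_tmul _ _ _ t x).trans (Algebra.smul_def _ _).symm
  have hsurj : Function.Surjective φ := by
    intro M
    let α := (M 0 0 + M 1 1) / 2
    let β := (M 0 1 + c * M 1 0) / (2 * c)
    let P := (M 0 0 - M 1 1) / 2
    let R := (c * M 1 0 - M 0 1) / (2 * c)
    let γ := (p * P - c * q * R) / algebraMap k F b
    let δ := (p * R - q * P) / algebraMap k F b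
    refine ⟨α ⊗ₜ 1 + β ⊗ₜ ⟨0, 1, 0, 0⟩ + γ ⊗ₜ ⟨0, 0, 1, 0⟩ + δ ⊗ₜ ⟨0, 0, 0, 1⟩, ?_⟩
    simp only [map_add, hφ]
    rw [← h] at hb'
    ext i j
    fin_cases i <;> fin_cases j <;>
      simp [quaternionLift, QuaternionAlgebra.lift, QuaternionAlgebra.Basis.lift, I, J,
        α, β, γ, δ, P, R, ← h] <;> field_simp <;> ring
  have hinj : Function.Injective φ.toLinearMap :=
    (LinearMap.injective_iff_surjective_of_finrank_eq_finrank (by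
      rw [Module.finrank_baseChange, QuaternionAlgebra.finrank_eq_four, Module.finrank_matrix]
      simp)).mpr hsurj
  exact ⟨AlgEquiv.ofBijective φ ⟨hinj, hsurj⟩⟩

end Quaternion

theorem affineQuadricPoly_normForm {k : Type*} [Field k] (a b : k) :
    affineQuadricPoly (QuadraticMap.weightedSumSquares k ![1, -a, -b, a * b]) =
      (MvPolynomial.X 0 ^ 2 - MvPolynomial.C a * MvPolynomial.X 1 ^ 2 -
        MvPolynomial.C b * MvPolynomial.X 2 ^ 2 + MvPolynomial.C (a * b) :
          MvPolynomial (Fin 3) k) := by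
  have hc : coeffMatrix (QuadraticMap.weightedSumSquares k ![1, -a, -b, a * b]) =
      Matrix.diagonal ![1, -a, -b, a * b] := by
    ext i j
    fin_cases i <;> fin_cases j <;>
      simp [coeffMatrix, QuadraticMap.polar, QuadraticMap.weightedSumSquares_apply,
        Fin.sum_univ_four, Pi.single_apply]
  rw [affineQuadricPoly, extendQF, hc]
  change Matrix.toQuadraticForm' _ _ = _
  simp [Matrix.toQuadraticForm', Matrix.toLinearMap₂'_apply,
    Fin.sum_univ_four, Matrix.diagonal_apply, MvPolynomial.algebraMap_eq]
  ring

theorem MvPolynomial.exists_injective_fractionField {k K E : Type*} [Field k] [Field K] [Field E]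
    [Algebra k K] [Algebra (Polynomial k) K] [IsScalarTower k (Polynomial k) K]
    [IsFractionRing (Polynomial k) K] [Algebra k E] [Algebra K E] [IsScalarTower k K E]
    [Algebra (Polynomial K) E] [IsScalarTower K (Polynomial K) E]
    [IsFractionRing (Polynomial K) E] :
    ∃ g : MvPolynomial (Fin 2) k →+* E, Function.Injective g ∧
      (∀ c, g (MvPolynomial.C c) = algebraMap k E c) ∧
      g (MvPolynomial.X 0) = algebraMap (Polynomial K) E Polynomial.X ∧
      g (MvPolynomial.X 1) = algebraMap (Polynomial K) E
        (Polynomial.C (algebraMap (Polynomial k) K Polynomial.X)) := by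
  let h : MvPolynomial (Fin 1) k →+* K := (algebraMap (Polynomial k) K).comp
    ((Polynomial.mapRingHom (MvPolynomial.isEmptyAlgEquiv k (Fin 0)).toRingHom).comp
      (MvPolynomial.finSuccEquiv k 0).toRingHom)
  have hh : Function.Injective h := (IsFractionRing.injective (Polynomial k) K).comp
    ((Polynomial.map_injective _ (MvPolynomial.isEmptyAlgEquiv k (Fin 0)).injective).comp
      (MvPolynomial.finSuccEquiv k 0).injective)
  have hC : ∀ c, h (MvPolynomial.C c) = algebraMap k K c := fun c => by
    have : (MvPolynomial.finSuccEquiv k 0) (MvPolynomial.C c) =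
        Polynomial.C (MvPolynomial.C c) := by simp [MvPolynomial.finSuccEquiv_apply]
    rw [IsScalarTower.algebraMap_apply k (Polynomial k) K]

    simp [h, this]
    exact MvPolynomial.coeff_zero_C c
  have hX : h (MvPolynomial.X 0) = algebraMap (Polynomial k) K Polynomial.X := by
    have := MvPolynomial.finSuccEquiv_X_zero (R := k) (n := 0)
    simp [h, this]
  refine ⟨(algebraMap (Polynomial K) E).comp
    ((Polynomial.mapRingHom h).comp (MvPolynomial.finSuccEquiv k 1).toRingHom), ?_, ?_, ?_, ?_⟩
  · exact (IsFractionRing.injective (Polynomial K) E).comp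
      ((Polynomial.map_injective _ hh).comp (MvPolynomial.finSuccEquiv k 1).injective)
  · intro c
    have : (MvPolynomial.finSuccEquiv k 1) (MvPolynomial.C c) =
        Polynomial.C (MvPolynomial.C c) := by simp [MvPolynomial.finSuccEquiv_apply]
    rw [IsScalarTower.algebraMap_apply k K E, IsScalarTower.algebraMap_apply K (Polynomial K) E]
    simp [this, hC]
  · have := MvPolynomial.finSuccEquiv_X_zero (R := k) (n := 1)
    simp [h, this]
  · have := MvPolynomial.finSuccEquiv_X_succ (R := k) (n := 1) (j := 0)
    simp only [Fin.succ_zero_eq_one] at this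
    simp [this, hX]

/-- If `θ² = g f` and `θ ∉ E`, the evaluation `R[X] → F` at `θ` has kernel generated
by `X² - f`. -/
theorem Polynomial.X_sq_sub_C_dvd_of_eval₂_eq_zero {R E F : Type*} [CommRing R] [Field E] [Field F]
    [Algebra E F] {g : R →+* E} (hg : Function.Injective g) {f : R} {θ : F}
    (hθ : θ * θ = algebraMap E F (g f)) (hθE : ∀ x : E, algebraMap E F x ≠ θ) {P : Polynomial R}
    (hP : P.eval₂ ((algebraMap E F).comp g) θ = 0) : X ^ 2 - C f ∣ P := by
  have : Nontrivial R := g.domain_nontrivial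
  have hm : (X ^ 2 - C f).Monic := monic_X_pow_sub_C f two_ne_zero
  have hdeg : (P %ₘ (X ^ 2 - C f)).degree ≤ 1 := by
    have := degree_modByMonic_lt P hm
    rw [degree_X_pow_sub_C two_pos] at this
    exact Order.le_of_lt_succ this
  rw [← modByMonic_eq_zero_iff_dvd hm]
  have hR := eq_X_add_C_of_degree_le_one hdeg
  generalize (P %ₘ (X ^ 2 - C f)).coeff 1 = r at hR
  generalize (P %ₘ (X ^ 2 - C f)).coeff 0 = s at hR
  rw [← modByMonic_add_div P (X ^ 2 - C f), hR] at hP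
  simp only [eval₂_add, eval₂_mul, eval₂_sub, eval₂_pow, eval₂_X, eval₂_C, RingHom.comp_apply,
    ← hθ, ← sq, sub_self, zero_mul, add_zero] at hP
  have hr : g r = 0 := by
    by_contra hr
    refine hθE (-(g s / g r)) ?_
    have : algebraMap E F (g r) ≠ 0 := by simpa using hr
    rw [map_neg, map_div₀, neg_eq_iff_eq_neg, div_eq_iff this]
    linear_combination hP
  rw [hr, map_zero, zero_mul, zero_add, map_eq_zero] at hP
  rw [hR, (map_eq_zero_iff g hg).1 hr, (map_eq_zero_iff g hg).1 hP]
  simp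

/-- The generic affine quadric surface `x² = a y² + b z² + c` over `E = k(y, z)`:
its right hand side is not a square when `a b ≠ 0`. -/
theorem sq_ne_of_rational_functions {k K E : Type*} [Field k] [Field K] [Field E]
    [Algebra k K] [Algebra (Polynomial k) K] [IsScalarTower k (Polynomial k) K]
    [IsFractionRing (Polynomial k) K] [Algebra k E] [Algebra K E] [IsScalarTower k K E]
    [Algebra (Polynomial K) E] [IsScalarTower K (Polynomial K) E]
    [IsFractionRing (Polynomial K) E] (h2 : (2 : k) ≠ 0) {a b : k} (c : k) (ha : a ≠ 0)
    (hb : b ≠ 0) (x : E) :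
    x ^ 2 ≠ algebraMap (Polynomial K) E
      (Polynomial.C (algebraMap k K a) * Polynomial.X ^ 2 + Polynomial.C (algebraMap (Polynomial k) K
        (Polynomial.C b * Polynomial.X ^ 2 + Polynomial.C c))) := by
  intro hx
  obtain ⟨i, j, hi, hj, hij⟩ := exists_quaternion_generators (k := k) (K := K) (E := E) (D := k)
    (d := algebraMap E (E ⊗[k] k) x) (by rw [← map_mul, ← sq, hx])
  rw [Algebra.algebraMap_self, RingHom.id_apply] at hi hj
  have : 2 * (i * j) = 0 := by linear_combination hij
  rcases mul_eq_zero.1 this with h | h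
  · exact h2 h
  rcases mul_eq_zero.1 h with rfl | rfl
  · exact ha (by simpa using hi.symm)
  · exact hb (by simpa using hj.symm)

/-- The affine coordinate ring of the norm quadric embeds into a quadratic extension `F` of
`E = k(y, z)` generated by a square root of `a y² + b z² - a b`. -/
theorem exists_injective_quadricCoordRing {k K E F : Type*} [Field k] [Field K] [Field E] [Field F]
    [Algebra k K] [Algebra (Polynomial k) K] [IsScalarTower k (Polynomial k) K]
    [IsFractionRing (Polynomial k) K] [Algebra k E] [Algebra K E] [IsScalarTower k K E]
    [Algebra (Polynomial K) E] [IsScalarTower K (Polynomial K) E]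
    [IsFractionRing (Polynomial K) E] [Algebra E F] [Algebra k F] [IsScalarTower k E F]
    (a b : k) {θ : F} (hθE : ∀ x : E, algebraMap E F x ≠ θ)
    (hθ : θ * θ = algebraMap E F (algebraMap (Polynomial K) E
      (Polynomial.C (algebraMap k K a) * Polynomial.X ^ 2 + Polynomial.C (algebraMap (Polynomial k) K
        (Polynomial.C b * Polynomial.X ^ 2 + Polynomial.C (-(a * b))))))) :
    ∃ φ : quadricCoordRing (QuadraticMap.weightedSumSquares k ![1, -a, -b, a * b]) →+* F,
      Function.Injective φ ∧ ∀ c : k, φ (algebraMap k _ c) = algebraMap k F c := by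
  obtain ⟨g, hg, hgC, hg0, hg1⟩ := MvPolynomial.exists_injective_fractionField
    (k := k) (K := K) (E := E)
  let f : MvPolynomial (Fin 2) k := MvPolynomial.C a * MvPolynomial.X 0 ^ 2 +
    MvPolynomial.C b * MvPolynomial.X 1 ^ 2 - MvPolynomial.C (a * b)
  have halg : ∀ c, algebraMap k E c = algebraMap (Polynomial K) E
      (Polynomial.C (algebraMap (Polynomial k) K (Polynomial.C c))) := fun c => by
    rw [IsScalarTower.algebraMap_apply k K E, IsScalarTower.algebraMap_apply K (Polynomial K) E,
      IsScalarTower.algebraMap_apply k (Polynomial k) K]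
    rfl
  have hgf : θ * θ = algebraMap E F (g f) := by
    rw [hθ, IsScalarTower.algebraMap_apply k (Polynomial k) K]
    congr 1
    simp only [f, map_sub, map_add, map_mul, map_pow, hgC, hg0, hg1, halg, map_neg,
      Polynomial.algebraMap_eq]
    ring
  let ψ : MvPolynomial (Fin 3) k →+* F :=
    (Polynomial.eval₂RingHom ((algebraMap E F).comp g) θ).comp
      (MvPolynomial.finSuccEquiv k 2).toRingHom
  have hC : ∀ c, MvPolynomial.finSuccEquiv k 2 (MvPolynomial.C c) =
      Polynomial.C (MvPolynomial.C c) := fun c => by simp [MvPolynomial.finSuccEquiv_apply]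
  have hq : MvPolynomial.finSuccEquiv k 2
      (affineQuadricPoly (QuadraticMap.weightedSumSquares k ![1, -a, -b, a * b])) =
        Polynomial.X ^ 2 - Polynomial.C f := by
    have h1 := MvPolynomial.finSuccEquiv_X_succ (R := k) (n := 2) (j := 0)
    have h2 := MvPolynomial.finSuccEquiv_X_succ (R := k) (n := 2) (j := 1)
    rw [affineQuadricPoly_normForm]
    change _ = Polynomial.C (MvPolynomial.X 0) at h1
    rw [show (Fin.succ 0 : Fin 3) = 1 from rfl] at h1
    rw [show (Fin.succ 1 : Fin 3) = 2 from rfl] at h2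
    rw [map_add, map_sub, map_sub, map_mul, map_mul, map_pow, map_pow, map_pow,
      MvPolynomial.finSuccEquiv_X_zero, h1, h2, hC, hC, hC]
    simp only [f, map_sub, map_add, map_mul, map_pow]
    ring
  have hker : ∀ p, ψ p = 0 ↔ p ∈ Ideal.span
      {affineQuadricPoly (QuadraticMap.weightedSumSquares k ![1, -a, -b, a * b])} := by
    intro p
    rw [Ideal.mem_span_singleton, ← map_dvd_iff (MvPolynomial.finSuccEquiv k 2), hq]
    constructor
    · exact Polynomial.X_sq_sub_C_dvd_of_eval₂_eq_zero hg hgf hθE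
    · rintro ⟨r, hr⟩
      change Polynomial.eval₂ _ θ (MvPolynomial.finSuccEquiv k 2 p) = 0
      rw [hr, Polynomial.eval₂_mul, Polynomial.eval₂_sub, Polynomial.eval₂_pow,
        Polynomial.eval₂_X, Polynomial.eval₂_C, RingHom.comp_apply, ← hgf, sq, sub_self, zero_mul]
  refine ⟨Ideal.Quotient.lift _ ψ fun p hp => (hker p).2 hp, ?_, fun c => ?_⟩
  · exact RingHom.lift_injective_of_ker_le_ideal _ _ fun p hp => (hker p).1 hp
  · change Polynomial.eval₂ _ θ (MvPolynomial.finSuccEquiv k 2 (MvPolynomial.C c)) = _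
    rw [hC, Polynomial.eval₂_C, RingHom.comp_apply, hgC, ← IsScalarTower.algebraMap_apply]

theorem exists_quadratic_field {E : Type u} [Field E] {f : E} (hf : ∀ x : E, x ^ 2 ≠ f) :
    ∃ (F : Type u) (_ : Field F) (_ : Algebra E F) (θ : F), Module.finrank E F = 2 ∧
      θ * θ = algebraMap E F f ∧ ∀ x : E, algebraMap E F x ≠ θ := by
  have hirr := X_pow_sub_C_irreducible_of_prime Nat.prime_two hf
  have := Fact.mk hirr
  have hroot : AdjoinRoot.root (Polynomial.X ^ 2 - Polynomial.C f) *
      AdjoinRoot.root (Polynomial.X ^ 2 - Polynomial.C f) =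
        algebraMap E (AdjoinRoot (Polynomial.X ^ 2 - Polynomial.C f)) f := by
    have := AdjoinRoot.eval₂_root (Polynomial.X ^ 2 - Polynomial.C f)
    rw [Polynomial.eval₂_sub, Polynomial.eval₂_pow, Polynomial.eval₂_X, Polynomial.eval₂_C,
      sub_eq_zero] at this
    exact (sq _).symm.trans this
  refine ⟨AdjoinRoot (Polynomial.X ^ 2 - Polynomial.C f), inferInstance, inferInstance,
    AdjoinRoot.root _, ?_, hroot, fun x hx => hf x ?_⟩
  · rw [(AdjoinRoot.powerBasis hirr.ne_zero).finrank, AdjoinRoot.powerBasis_dim,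
      Polynomial.natDegree_X_pow_sub_C]
  · rw [← hx, ← map_mul] at hroot
    rw [sq]
    exact (algebraMap E _).injective hroot

/-- A central simple algebra that splits over the quadratic extension of `k(y, z)` generated by a
square root of `a y² + b z² + c` is split or Brauer equivalent to `ℍ(a,b)`. -/
theorem isSplitAlg_or_brauerEquiv_of_split {k K E F : Type*} {A : Type u} [Field k] [Field K]
    [Field E] [Field F] [Algebra k K] [Algebra (Polynomial k) K] [IsScalarTower k (Polynomial k) K]
    [IsFractionRing (Polynomial k) K] [Algebra k E] [Algebra K E] [IsScalarTower k K E]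
    [Algebra (Polynomial K) E] [IsScalarTower K (Polynomial K) E]
    [IsFractionRing (Polynomial K) E] [Algebra E F] [Algebra k F] [IsScalarTower k E F]
    [Ring A] [Algebra k A] [IsSimpleRing A] [FiniteDimensional k A] {a b c : k}
    (haniso : (QuadraticMap.weightedSumSquares k ![1, -a, -b, a * b]).Anisotropic)
    (hF : Module.finrank E F = 2) {θ : F}
    (hθ : θ * θ = algebraMap E F (algebraMap (Polynomial K) E
      (Polynomial.C (algebraMap k K a) * Polynomial.X ^ 2 + Polynomial.C (algebraMap (Polynomial k) K
        (Polynomial.C b * Polynomial.X ^ 2 + Polynomial.C c)))))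
    (hA : SplitsIn k A F) : IsSplitAlg k A ∨ BrauerEquiv k A ℍ[k,a,b] := by
  have : IsArtinianRing A := IsArtinianRing.of_finite k A
  obtain ⟨r, hr, D, _, _, _, ⟨eA⟩⟩ := IsSimpleRing.exists_algEquiv_matrix_divisionRing_finite k A
  have hr0 : 0 < r := Nat.pos_of_ne_zero hr.out
  obtain ⟨N, hN, ⟨e⟩⟩ := hA
  obtain ⟨n, hn, ⟨eD⟩⟩ := exists_algEquiv_matrix_of_matrix_algEquiv hr0 hN
    ((baseChangeMatrixEquiv k F D r).symm.trans
      ((Algebra.TensorProduct.congr AlgEquiv.refl eA.symm).trans e))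
  have := isDomain_baseChange_baseChange (k := k) (K := K) (E := E) (D := D)
  rcases degree_le_two_of_split_quadratic hF hθ hn eD with hD | ⟨hD, d, hd⟩
  · left
    have hbij : Function.Bijective (algebraMap k D) :=
      Algebra.finrank_eq_one_iff_bijective_algebraMap.mp hD
    exact ⟨r, hr0, ⟨eA.trans (AlgEquiv.ofBijective (Algebra.ofId k D) hbij).symm.mapMatrix⟩⟩
  · right
    obtain ⟨i, j, hi, hj, hij⟩ := exists_quaternion_generators hd
    obtain ⟨eH⟩ := nonempty_algEquiv_quaternion haniso hD hi hj hij
    exact ⟨1, r, one_pos, hr0,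
      ⟨(eA.trans eH.mapMatrix).mapMatrix.trans ((Matrix.compAlgEquiv (Fin 1) (Fin r) _ k).trans
        (Matrix.reindexAlgEquiv k _ (Equiv.uniqueProd (Fin r) (Fin 1))))⟩⟩

theorem IsSplitAlg.splitsIn {k A F : Type*} [Field k] [Ring A] [Algebra k A] [Field F]
    [Algebra k F] (hA : IsSplitAlg k A) : SplitsIn k A F := by
  obtain ⟨n, hn, ⟨e⟩⟩ := hA
  exact ⟨n, hn, ⟨(Algebra.TensorProduct.congr AlgEquiv.refl e).trans
    ((baseChangeMatrixEquiv k F k n).trans (Algebra.TensorProduct.rid k F F).mapMatrix)⟩⟩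

theorem BrauerEquiv.splitsIn {k A B F : Type*} [Field k] [Ring A] [Algebra k A] [Ring B]
    [Algebra k B] [Field F] [Algebra k F] (hAB : BrauerEquiv k A B) (hB : SplitsIn k B F) :
    SplitsIn k A F := by
  obtain ⟨n, m, hn, hm, ⟨e⟩⟩ := hAB
  obtain ⟨r, hr, ⟨eB⟩⟩ := hB
  exact exists_algEquiv_matrix_of_matrix_algEquiv hn (Nat.mul_pos hm hr)
    ((baseChangeMatrixEquiv k F A n).symm.trans
      ((Algebra.TensorProduct.congr AlgEquiv.refl e).trans
        ((baseChangeMatrixEquiv k F B m).trans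
          (eB.mapMatrix.trans ((Matrix.compAlgEquiv (Fin m) (Fin r) F F).trans
            (Matrix.reindexAlgEquiv F F finProdFinEquiv))))))

theorem SplitsIn.of_algebra {k A K F : Type*} [Field k] [Ring A] [Algebra k A] [CommRing K]
    [Algebra k K] [CommRing F] [Algebra k F] [Algebra K F] [IsScalarTower k K F]
    (hA : SplitsIn k A K) : SplitsIn k A F := by
  obtain ⟨n, hn, ⟨e⟩⟩ := hA
  exact ⟨n, hn, exists_algEquiv_matrix_baseChange e⟩

/-- The quaternion algebra `ℍ(a,b)` splits over every field in which its norm quadric has an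
affine point. -/
theorem splitsIn_quaternion_of_point {k F : Type*} [Field k] [Field F] [Algebra k F]
    (h2 : (2 : k) ≠ 0) {a b : k} (ha : a ≠ 0) (hb : b ≠ 0) (ψ : MvPolynomial (Fin 3) k →ₐ[k] F)
    (h : ψ (affineQuadricPoly (QuadraticMap.weightedSumSquares k ![1, -a, -b, a * b])) = 0) :
    SplitsIn k ℍ[k,a,b] F := by
  have hC : ∀ c, ψ (MvPolynomial.C c) = algebraMap k F c := ψ.commutes
  rw [affineQuadricPoly_normForm, map_add, map_sub, map_sub, map_mul, map_mul, map_pow, map_pow,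
    map_pow, hC, hC, hC, map_mul] at h
  have h2' : (2 : F) ≠ 0 := by
    rw [← map_ofNat (algebraMap k F) 2]
    simpa using h2
  obtain ⟨p, q, hpq⟩ := exists_eq_sq_sub_mul_sq_of_quadric_point h2' (by simpa using ha) h
  exact ⟨2, two_pos, nonempty_baseChange_quaternion_algEquiv h2' ha hb hpq⟩

theorem stmt_11 (k : Type u) [Field k] (h2 : (2 : k) ≠ 0) (a b : k) (ha : a ≠ 0) (hb : b ≠ 0)
    (haniso : (QuadraticMap.weightedSumSquares k ![1, -a, -b, a * b]).Anisotropic) :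
    (∀ (A : Type u) [Ring A] [Algebra k A] [Algebra.IsCentral k A] [IsSimpleRing A]
        [FiniteDimensional k A],
      SplitsIn k A
          (quadricFunctionField (QuadraticMap.weightedSumSquares k ![1, -a, -b, a * b])) ↔
        (IsSplitAlg k A ∨ BrauerEquiv k A (ℍ[k,a,b]))) ∧
    ¬IsSplitAlg k (ℍ[k,a,b]) := by
  have hsq := sq_ne_of_rational_functions (K := FractionRing (Polynomial k))
    (E := FractionRing (Polynomial (FractionRing (Polynomial k)))) h2 (-(a * b)) ha hb
  obtain ⟨F, _, _, θ, hF, hθ, hθE⟩ := exists_quadratic_field hsq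
  let _ : Algebra k F := ((algebraMap (FractionRing (Polynomial (FractionRing (Polynomial k)))) F).comp
    (algebraMap k _)).toAlgebra
  have : IsScalarTower k (FractionRing (Polynomial (FractionRing (Polynomial k)))) F :=
    .of_algebraMap_eq fun _ => rfl
  obtain ⟨φ, hφ, hφk⟩ := exists_injective_quadricCoordRing a b hθE hθ
  have : IsDomain (quadricCoordRing (QuadraticMap.weightedSumSquares k ![1, -a, -b, a * b])) :=
    hφ.isDomain φ
  let Φ : quadricFunctionField (QuadraticMap.weightedSumSquares k ![1, -a, -b, a * b]) →+* F :=
    IsFractionRing.lift hφ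
  let _ : Algebra (quadricFunctionField (QuadraticMap.weightedSumSquares k ![1, -a, -b, a * b])) F :=
    Φ.toAlgebra
  have : IsScalarTower k
      (quadricFunctionField (QuadraticMap.weightedSumSquares k ![1, -a, -b, a * b])) F := by
    refine .of_algebraMap_eq fun c => ?_
    rw [IsScalarTower.algebraMap_apply k
      (quadricCoordRing (QuadraticMap.weightedSumSquares k ![1, -a, -b, a * b]))
      (quadricFunctionField _), ← hφk]
    exact (IsFractionRing.lift_algebraMap hφ _).symm
  have hH : SplitsIn k ℍ[k,a,b]
      (quadricFunctionField (QuadraticMap.weightedSumSquares k ![1, -a, -b, a * b])) := by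
    refine splitsIn_quaternion_of_point h2 ha hb ((IsScalarTower.toAlgHom k
      (quadricCoordRing (QuadraticMap.weightedSumSquares k ![1, -a, -b, a * b])) _).comp
        (Ideal.Quotient.mkₐ k _)) ?_
    rw [AlgHom.comp_apply, Ideal.Quotient.mkₐ_eq_mk,
      Ideal.Quotient.eq_zero_iff_mem.2 (Ideal.mem_span_singleton_self _), map_zero]
  refine ⟨fun A _ _ _ _ _ => ⟨fun hA => ?_, ?_⟩, fun ⟨_, _, ⟨e⟩⟩ => not_isSplit_quaternion haniso e⟩
  · exact isSplitAlg_or_brauerEquiv_of_split haniso hF hθ hA.of_algebra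
  · rintro (hA | hA)
    · exact hA.splitsIn
    · exact hA.splitsIn hH

end
end
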